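/- arXiv:0912.0911 — 13 statements merged into one kernel-verified Lean document; each statement's English description precedes it below -/
import Mathlib

section
/- Let S and T be six-vertex matrices all of whose weights a₁(S), a₂(S), b₁(S), b₂(S), c₁(S), c₂(S), a₁(T), a₂(T), b₁(T), b₂(T), c₁(T), c₂(T) are nonzero, and suppose Δ₁(S) = Δ₁(T) and Δ₂(S) = Δ₂(T). Define the six-vertex matrix R by a₁(R) = (b₂(S)a₁(T)b₁(T) − a₁(S)b₁(T)b₂(T) + a₁(S)c₁(T)c₂(T))/a₁(T), a₂(R) = (b₁(S)a₂(T)b₂(T) − a₂(S)b₁(T)b₂(T) + a₂(S)c₁(T)c₂(T))/a₂(T), b₁(R) = b₁(S)a₂(T) − a₂(S)b₁(T), b₂(R) = b₂(S)a₁(T) − a₁(S)b₂(T), c₁(R) = c₁(S)c₂(T), c₂(R) = c₂(S)c₁(T). Then c₁(R) ≠ 0, c₂(R) ≠ 0, and ⟦R,S,T⟧ = 0. -/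
open Matrix

noncomputable section

abbrev M4 : Type := Matrix (Fin 4) (Fin 4) ℂ
abbrev I3 : Type := Fin 2 × Fin 2 × Fin 2
abbrev M8 : Type := Matrix I3 I3 ℂ

/-- Index of `v_a ⊗ v_b` in the ordered basis `(v₊⊗v₊, v₊⊗v₋, v₋⊗v₊, v₋⊗v₋)` of `V ⊗ V`. -/
def idx (a b : Fin 2) : Fin 4 := ⟨2 * a.val + b.val, by have := a.isLt; have := b.isLt; omega⟩

/-- `R₁₂ = R ⊗ I` acting on `V ⊗ V ⊗ V`. -/
def m12 (R : M4) : M8 :=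
  Matrix.of fun p q => R (idx p.1 p.2.1) (idx q.1 q.2.1) * (if p.2.2 = q.2.2 then 1 else 0)

/-- `R₁₃ = (I⊗P)(R⊗I)(I⊗P)`: `R` acting on the first and third factors. -/
def m13 (R : M4) : M8 :=
  Matrix.of fun p q => R (idx p.1 p.2.2) (idx q.1 q.2.2) * (if p.2.1 = q.2.1 then 1 else 0)

/-- `R₂₃ = I ⊗ R` acting on `V ⊗ V ⊗ V`. -/
def m23 (R : M4) : M8 :=
  Matrix.of fun p q => (if p.1 = q.1 then 1 else 0) * R (idx p.2.1 p.2.2) (idx q.2.1 q.2.2)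

/-- The Yang–Baxter commutator `⟦R,S,T⟧ = R₁₂ S₁₃ T₂₃ − T₂₃ S₁₃ R₁₂`. -/
def ybc (R S T : M4) : M8 := m12 R * m13 S * m23 T - m23 T * m13 S * m12 R

/-- The six-vertex matrix with Boltzmann weights `a₁ a₂ b₁ b₂ c₁ c₂` (and `d₁ = d₂ = 0`). -/
def sixV (a₁ a₂ b₁ b₂ c₁ c₂ : ℂ) : M4 :=
  !![a₁, 0, 0, 0; 0, b₁, c₁, 0; 0, c₂, b₂, 0; 0, 0, 0, a₂]

/-- The general R-matrix with Boltzmann weights `a₁ a₂ b₁ b₂ c₁ c₂ d₁ d₂`. -/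
def rmat (a₁ a₂ b₁ b₂ c₁ c₂ d₁ d₂ : ℂ) : M4 :=
  !![a₁, 0, 0, d₁; 0, b₁, c₁, 0; 0, c₂, b₂, 0; d₂, 0, 0, a₂]

set_option maxHeartbeats 4000000 in
/-- The Yang–Baxter equation for six-vertex matrices, reduced to two relations on each of the
weights `ra₁` and `ra₂`. -/
theorem ybc_sixV_eq_zero {ra₁ ra₂ sa₁ sa₂ sb₁ sb₂ sc₁ sc₂ ta₁ ta₂ tb₁ tb₂ tc₁ tc₂ : ℂ}
    (ht₁ : ra₁ * ta₁ = tb₁ * (sb₂ * ta₁ - sa₁ * tb₂) + sa₁ * tc₁ * tc₂)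
    (ht₂ : ra₂ * ta₂ = tb₂ * (sb₁ * ta₂ - sa₂ * tb₁) + sa₂ * tc₁ * tc₂)
    (hs₁ : ra₁ * sb₁ = sa₁ * (sb₁ * ta₂ - sa₂ * tb₁) + tb₁ * sc₁ * sc₂)
    (hs₂ : ra₂ * sb₂ = sa₂ * (sb₂ * ta₁ - sa₁ * tb₂) + tb₂ * sc₁ * sc₂) :
    ybc
      (sixV ra₁ ra₂ (sb₁ * ta₂ - sa₂ * tb₁) (sb₂ * ta₁ - sa₁ * tb₂) (sc₁ * tc₂) (sc₂ * tc₁))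
      (sixV sa₁ sa₂ sb₁ sb₂ sc₁ sc₂)
      (sixV ta₁ ta₂ tb₁ tb₂ tc₁ tc₂) = 0 := by
  ext ⟨i, j, k⟩ ⟨l, m, n⟩
  fin_cases i <;> fin_cases j <;> fin_cases k <;> fin_cases l <;> fin_cases m <;> fin_cases n <;>
    simp [ybc, m12, m13, m23, sixV, idx, Matrix.mul_apply, Fintype.sum_prod_type] <;>
    first
    | ring1
    | linear_combination tc₁ * hs₁
    | linear_combination sc₁ * ht₁
    | linear_combination -tc₂ * hs₁
    | linear_combination -sc₂ * ht₁
    | linear_combination -tc₁ * hs₂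
    | linear_combination -sc₁ * ht₂
    | linear_combination tc₂ * hs₂
    | linear_combination sc₂ * ht₂

theorem stmt0
    (sa₁ sa₂ sb₁ sb₂ sc₁ sc₂ ta₁ ta₂ tb₁ tb₂ tc₁ tc₂ : ℂ)
    (hsa₁ : sa₁ ≠ 0) (hsa₂ : sa₂ ≠ 0) (hsb₁ : sb₁ ≠ 0) (hsb₂ : sb₂ ≠ 0)
    (hsc₁ : sc₁ ≠ 0) (hsc₂ : sc₂ ≠ 0)
    (hta₁ : ta₁ ≠ 0) (hta₂ : ta₂ ≠ 0) (htb₁ : tb₁ ≠ 0) (htb₂ : tb₂ ≠ 0)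
    (htc₁ : tc₁ ≠ 0) (htc₂ : tc₂ ≠ 0)
    (hΔ₁ : (sa₁ * sa₂ + sb₁ * sb₂ - sc₁ * sc₂) / (2 * sa₁ * sb₁)
         = (ta₁ * ta₂ + tb₁ * tb₂ - tc₁ * tc₂) / (2 * ta₁ * tb₁))
    (hΔ₂ : (sa₁ * sa₂ + sb₁ * sb₂ - sc₁ * sc₂) / (2 * sa₂ * sb₂)
         = (ta₁ * ta₂ + tb₁ * tb₂ - tc₁ * tc₂) / (2 * ta₂ * tb₂)) :
    sc₁ * tc₂ ≠ 0 ∧ sc₂ * tc₁ ≠ 0 ∧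
    ybc
      (sixV ((sb₂ * ta₁ * tb₁ - sa₁ * tb₁ * tb₂ + sa₁ * tc₁ * tc₂) / ta₁)
            ((sb₁ * ta₂ * tb₂ - sa₂ * tb₁ * tb₂ + sa₂ * tc₁ * tc₂) / ta₂)
            (sb₁ * ta₂ - sa₂ * tb₁) (sb₂ * ta₁ - sa₁ * tb₂)
            (sc₁ * tc₂) (sc₂ * tc₁))
      (sixV sa₁ sa₂ sb₁ sb₂ sc₁ sc₂)
      (sixV ta₁ ta₂ tb₁ tb₂ tc₁ tc₂) = 0 := by
  rw [div_eq_div_iff (by simp [*]) (by simp [*])] at hΔ₁ hΔ₂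
  refine ⟨mul_ne_zero hsc₁ htc₂, mul_ne_zero hsc₂ htc₁, ybc_sixV_eq_zero ?_ ?_ ?_ ?_⟩
  · field_simp
  · field_simp
  · rw [div_mul_eq_mul_div, div_eq_iff hta₁]
    linear_combination hΔ₁ / 2
  · rw [div_mul_eq_mul_div, div_eq_iff hta₂]
    linear_combination hΔ₂ / 2
end
end

section
/- Let S and T be six-vertex matrices all of whose weights a₁(S), a₂(S), b₁(S), b₂(S), c₁(S), c₂(S), a₁(T), a₂(T), b₁(T), b₂(T), c₁(T), c₂(T) are nonzero. If there exists a six-vertex matrix R with c₁(R) ≠ 0 and c₂(R) ≠ 0 such that ⟦R,S,T⟧ = 0, then Δ₁(S) = Δ₁(T) and Δ₂(S) = Δ₂(T). -/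
open Matrix

noncomputable section

/-- The matrix entries of the six-vertex Yang–Baxter equation that determine the weights of the
first factor up to scaling. -/
theorem sixV_yang_baxter_entries
    {ra₁ ra₂ rb₁ rb₂ rc₁ rc₂ sa₁ sa₂ sb₁ sb₂ sc₁ sc₂ ta₁ ta₂ tb₁ tb₂ tc₁ tc₂ : ℂ}
    (h : ybc (sixV ra₁ ra₂ rb₁ rb₂ rc₁ rc₂) (sixV sa₁ sa₂ sb₁ sb₂ sc₁ sc₂)
      (sixV ta₁ ta₂ tb₁ tb₂ tc₁ tc₂) = 0) :
    rc₂ * sc₁ * tc₂ = rc₁ * sc₂ * tc₁ ∧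
    rb₂ * sc₁ * tc₂ = rc₁ * (sb₂ * ta₁ - sa₁ * tb₂) ∧
    rb₁ * sc₁ * tc₂ = rc₁ * (sb₁ * ta₂ - sa₂ * tb₁) ∧
    ra₁ * sb₁ * tc₁ = rc₂ * sc₁ * tb₁ + rb₁ * sa₁ * tc₁ ∧
    ra₁ * sc₁ * ta₁ = rb₂ * sc₁ * tb₁ + rc₁ * sa₁ * tc₁ ∧
    ra₂ * sc₁ * ta₂ = rb₁ * sc₁ * tb₂ + rc₁ * sa₂ * tc₁ ∧
    ra₂ * sb₂ * tc₁ = rc₂ * sc₁ * tb₂ + rb₂ * sa₂ * tc₁ := by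
  have entry (p q : I3) := congrFun (congrFun h p) q
  have e0 := entry (0, 1, 0) (0, 1, 0)
  have e1 := entry (0, 1, 0) (1, 0, 0)
  have e2 := entry (0, 1, 1) (1, 0, 1)
  have e3 := entry (0, 0, 1) (0, 1, 0)
  have e4 := entry (0, 0, 1) (1, 0, 0)
  have e5 := entry (0, 1, 1) (1, 1, 0)
  have e6 := entry (1, 0, 1) (1, 1, 0)
  simp [ybc, m12, m13, m23, sixV, idx, Matrix.mul_apply, Fintype.sum_prod_type]
    at e0 e1 e2 e3 e4 e5 e6
  refine ⟨?_, ?_, ?_, ?_, ?_, ?_, ?_⟩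
  · linear_combination -e0
  · linear_combination -e1
  · linear_combination e2
  · linear_combination e3
  · linear_combination e4
  · linear_combination -e5
  · linear_combination -e6

theorem stmt1
    (sa₁ sa₂ sb₁ sb₂ sc₁ sc₂ ta₁ ta₂ tb₁ tb₂ tc₁ tc₂ : ℂ)
    (hsa₁ : sa₁ ≠ 0) (hsa₂ : sa₂ ≠ 0) (hsb₁ : sb₁ ≠ 0) (hsb₂ : sb₂ ≠ 0)
    (hsc₁ : sc₁ ≠ 0) (hsc₂ : sc₂ ≠ 0)
    (hta₁ : ta₁ ≠ 0) (hta₂ : ta₂ ≠ 0) (htb₁ : tb₁ ≠ 0) (htb₂ : tb₂ ≠ 0)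
    (htc₁ : tc₁ ≠ 0) (htc₂ : tc₂ ≠ 0)
    (h : ∃ ra₁ ra₂ rb₁ rb₂ rc₁ rc₂ : ℂ, rc₁ ≠ 0 ∧ rc₂ ≠ 0 ∧
        ybc (sixV ra₁ ra₂ rb₁ rb₂ rc₁ rc₂)
            (sixV sa₁ sa₂ sb₁ sb₂ sc₁ sc₂)
            (sixV ta₁ ta₂ tb₁ tb₂ tc₁ tc₂) = 0) :
    (sa₁ * sa₂ + sb₁ * sb₂ - sc₁ * sc₂) / (2 * sa₁ * sb₁)
      = (ta₁ * ta₂ + tb₁ * tb₂ - tc₁ * tc₂) / (2 * ta₁ * tb₁) ∧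
    (sa₁ * sa₂ + sb₁ * sb₂ - sc₁ * sc₂) / (2 * sa₂ * sb₂)
      = (ta₁ * ta₂ + tb₁ * tb₂ - tc₁ * tc₂) / (2 * ta₂ * tb₂) := by
  obtain ⟨ra₁, ra₂, rb₁, rb₂, rc₁, rc₂, hrc₁, -, h⟩ := h
  obtain ⟨hc, hb₂, hb₁, ha₁, ha₁', ha₂, ha₂'⟩ := sixV_yang_baxter_entries h
  have hrt : rc₁ * tc₁ ≠ 0 := mul_ne_zero hrc₁ htc₁
  constructor
  · rw [div_eq_div_iff (by simp [*]) (by simp [*])]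
    apply mul_left_cancel₀ hrt
    linear_combination 2 * (sc₁ * ta₁ * tc₂ * ha₁ - sb₁ * tc₁ * tc₂ * ha₁'
      + sc₁ * ta₁ * tb₁ * hc + sa₁ * ta₁ * tc₁ * hb₁ - sb₁ * tb₁ * tc₁ * hb₂)
  · rw [div_eq_div_iff (by simp [*]) (by simp [*])]
    apply mul_left_cancel₀ hrt
    linear_combination 2 * (sc₁ * ta₂ * tc₂ * ha₂' - sb₂ * tc₁ * tc₂ * ha₂
      + sc₁ * ta₂ * tb₂ * hc + sa₂ * ta₂ * tc₁ * hb₂ - sb₂ * tb₂ * tc₁ * hb₁)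
end
end

section
/- Let S and T be free-fermionic six-vertex matrices with c₁(T)c₂(T) ≠ 0. Then π(T) is invertible, there is a unique six-vertex matrix R with π(R) = π(S)·π(T)⁻¹, this R satisfies ⟦R,S,T⟧ = 0, and R is again free-fermionic, i.e. a₁(R)a₂(R) + b₁(R)b₂(R) − c₁(R)c₂(R) = 0. -/
open Matrix

noncomputable section

/-- `R` is a six-vertex matrix: all entries vanish except the weights
`a₁ = R 0 0`, `b₁ = R 1 1`, `c₁ = R 1 2`, `c₂ = R 2 1`, `b₂ = R 2 2`, `a₂ = R 3 3`. -/
def IsSixVertex (R : M4) : Prop :=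
  R = sixV (R 0 0) (R 3 3) (R 1 1) (R 2 2) (R 1 2) (R 2 1)

/-- A six-vertex matrix is free-fermionic if `a₁a₂ + b₁b₂ - c₁c₂ = 0`. -/
def IsFreeFermionic (R : M4) : Prop :=
  R 0 0 * R 3 3 + R 1 1 * R 2 2 - R 1 2 * R 2 1 = 0

/-- The map `π` of Theorem 2 (groupcase): `π(R) = [[c₁,0,0,0],[0,a₁,b₂,0],[0,−b₁,a₂,0],[0,0,0,c₂]]`. -/
def piMap (R : M4) : M4 :=
  !![R 1 2, 0, 0, 0; 0, R 0 0, R 2 2, 0; 0, -(R 1 1), R 3 3, 0; 0, 0, 0, R 2 1]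

lemma isSixVertex_sixV (a₁ a₂ b₁ b₂ c₁ c₂ : ℂ) : IsSixVertex (sixV a₁ a₂ b₁ b₂ c₁ c₂) := rfl

lemma IsSixVertex.ext {R R' : M4} (hR : IsSixVertex R) (hR' : IsSixVertex R')
    (h : piMap R = piMap R') : R = R' := by
  have h00 := congrFun (congrFun h 0) 0
  have h11 := congrFun (congrFun h 1) 1
  have h12 := congrFun (congrFun h 1) 2
  have h21 := congrFun (congrFun h 2) 1
  have h22 := congrFun (congrFun h 2) 2
  have h33 := congrFun (congrFun h 3) 3
  simp [piMap] at h00 h11 h12 h21 h22 h33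
  rw [hR, hR', h00, h11, h12, h21, h22, h33]

lemma piMap_mul_piMap (R T : M4) :
    piMap R * piMap T = piMap (sixV
      (R 0 0 * T 0 0 - R 2 2 * T 1 1) (R 3 3 * T 3 3 - R 1 1 * T 2 2)
      (R 1 1 * T 0 0 + R 3 3 * T 1 1) (R 0 0 * T 2 2 + R 2 2 * T 3 3)
      (R 1 2 * T 1 2) (R 2 1 * T 2 1)) := by
  ext i j
  fin_cases i <;> fin_cases j <;> simp [piMap, sixV, Matrix.mul_apply, Fin.sum_univ_four] <;> ring

/-- The inverse of `piMap T`, as the image under `piMap` of a six-vertex matrix. -/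
def sixVInv (T : M4) : M4 :=
  sixV (T 3 3 / (T 1 2 * T 2 1)) (T 0 0 / (T 1 2 * T 2 1))
    (-T 1 1 / (T 1 2 * T 2 1)) (-T 2 2 / (T 1 2 * T 2 1)) (1 / T 1 2) (1 / T 2 1)

lemma piMap_mul_piMap_sixVInv {T : M4} (hT : IsFreeFermionic T) (hc : T 1 2 * T 2 1 ≠ 0) :
    piMap T * piMap (sixVInv T) = 1 := by
  have h₁ : T 1 2 ≠ 0 := left_ne_zero_of_mul hc
  have h₂ : T 2 1 ≠ 0 := right_ne_zero_of_mul hc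
  have hT' : T 0 0 * T 3 3 + T 1 1 * T 2 2 - T 1 2 * T 2 1 = 0 := hT
  ext i j
  fin_cases i <;> fin_cases j <;>
    simp [piMap, sixVInv, sixV, Matrix.mul_apply, Fin.sum_univ_four, h₁, h₂] <;>
    field_simp <;> grind

set_option maxHeartbeats 4000000 in
lemma ybc_sixV {a₁ a₂ b₁ b₂ c₁ c₂ x₁ x₂ y₁ y₂ z₁ z₂ : ℂ}
    (hR : a₁ * a₂ + b₁ * b₂ - c₁ * c₂ = 0) (hT : x₁ * x₂ + y₁ * y₂ - z₁ * z₂ = 0) :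
    ybc (sixV a₁ a₂ b₁ b₂ c₁ c₂)
      (sixV (a₁ * x₁ - b₂ * y₁) (a₂ * x₂ - b₁ * y₂) (b₁ * x₁ + a₂ * y₁) (a₁ * y₂ + b₂ * x₂)
        (c₁ * z₁) (c₂ * z₂))
      (sixV x₁ x₂ y₁ y₂ z₁ z₂) = 0 := by
  ext ⟨i, j, k⟩ ⟨l, m, n⟩
  fin_cases i <;> fin_cases j <;> fin_cases k <;> fin_cases l <;> fin_cases m <;> fin_cases n <;>
    simp [ybc, m12, m13, m23, idx, sixV, Matrix.mul_apply, Fintype.sum_prod_type] <;>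
    grind

theorem stmt2 (S T : M4)
    (hS : IsSixVertex S) (hT : IsSixVertex T)
    (hSff : IsFreeFermionic S) (hTff : IsFreeFermionic T)
    (hTc : T 1 2 * T 2 1 ≠ 0) :
    IsUnit (piMap T) ∧
    (∃! R : M4, IsSixVertex R ∧ piMap R = piMap S * (piMap T)⁻¹) ∧
    (∀ R : M4, IsSixVertex R → piMap R = piMap S * (piMap T)⁻¹ →
      ybc R S T = 0 ∧ IsFreeFermionic R) := by
  have hinv := piMap_mul_piMap_sixVInv hTff hTc
  have hu : IsUnit (piMap T) := IsUnit.of_mul_eq_one _ hinv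
  have hdet : IsUnit (piMap T).det := (Matrix.isUnit_iff_isUnit_det _).mp hu
  refine ⟨hu, ?_, ?_⟩
  · rw [Matrix.inv_eq_right_inv hinv, piMap_mul_piMap]
    refine ⟨_, ⟨isSixVertex_sixV .., rfl⟩, ?_⟩
    rintro R ⟨hR, h⟩
    exact hR.ext (isSixVertex_sixV ..) h
  · intro R hR h
    have hmul : piMap S = piMap R * piMap T := by
      rw [h, Matrix.nonsing_inv_mul_cancel_right _ _ hdet]
    rw [piMap_mul_piMap] at hmul
    have hS' := hS.ext (isSixVertex_sixV ..) hmul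
    have hRff : IsFreeFermionic R := by
      rw [hS'] at hSff
      simp only [IsFreeFermionic] at hSff hTff ⊢
      simp [sixV] at hSff
      refine (mul_eq_zero.mp ?_).resolve_right hTc
      linear_combination hSff - (R 0 0 * R 3 3 + R 1 1 * R 2 2) * hTff
    refine ⟨?_, hRff⟩
    rw [hS', hR, hT]
    exact ybc_sixV hRff hTff
end
end

section
/- Define σ : GL₂(ℂ) × ℂˣ → End(V⊗V) by letting σ(A,u) be the six-vertex matrix with a₁ = A₁₁, b₂ = A₁₂, b₁ = −A₂₁, a₂ = A₂₂, c₁ = u, c₂ = det(A)/u. Then: (i) σ is injective; (ii) the image of σ is exactly the set of free-fermionic six-vertex matrices R with c₁(R) ≠ 0 and c₂(R) ≠ 0; (iii) σ satisfies the parametrized Yang–Baxter equation with nonabelian parameter group GL₂(ℂ) × ℂˣ: for all g, h ∈ GL₂(ℂ) × ℂˣ (with componentwise multiplication (A,u)·(A′,u′) = (AA′, uu′)), σ(g)₁₂ σ(g·h)₁₃ σ(h)₂₃ = σ(h)₂₃ σ(g·h)₁₃ σ(g)₁₂, i.e. ⟦σ(g), σ(g·h), σ(h)⟧ = 0. -/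
open Matrix

noncomputable section

/-- The parametrization `σ : GL₂(ℂ) × ℂˣ → End(V⊗V)`: the six-vertex matrix with
`a₁ = A₁₁`, `b₂ = A₁₂`, `b₁ = −A₂₁`, `a₂ = A₂₂`, `c₁ = u`, `c₂ = det A / u`. -/
def sigmaFF (g : Matrix.GeneralLinearGroup (Fin 2) ℂ × ℂˣ) : M4 :=
  sixV ((g.1 : Matrix (Fin 2) (Fin 2) ℂ) 0 0)
       ((g.1 : Matrix (Fin 2) (Fin 2) ℂ) 1 1)
       (-((g.1 : Matrix (Fin 2) (Fin 2) ℂ) 1 0))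
       ((g.1 : Matrix (Fin 2) (Fin 2) ℂ) 0 1)
       (g.2 : ℂ)
       ((g.1 : Matrix (Fin 2) (Fin 2) ℂ).det / (g.2 : ℂ))

lemma sigmaFF_injective : Function.Injective sigmaFF := by
  rintro ⟨A, u⟩ ⟨B, v⟩ h
  have entry (i j : Fin 4) := congrFun (congrFun h i) j
  have h00 := entry 0 0
  have h11 := entry 1 1
  have h22 := entry 2 2
  have h33 := entry 3 3
  have h12 := entry 1 2
  simp [sigmaFF, sixV] at h00 h11 h22 h33 h12
  refine Prod.ext (Units.ext ?_) (Units.ext h12)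
  ext i j
  fin_cases i <;> fin_cases j <;> simpa

lemma range_sigmaFF :
    Set.range sigmaFF
      = {R : M4 | IsSixVertex R ∧ IsFreeFermionic R ∧ R 1 2 ≠ 0 ∧ R 2 1 ≠ 0} := by
  ext R
  constructor
  · rintro ⟨⟨A, u⟩, rfl⟩
    have hu : (u : ℂ) ≠ 0 := u.ne_zero
    have hA : (A : Matrix (Fin 2) (Fin 2) ℂ).det ≠ 0 := A.det_ne_zero
    refine ⟨by simp [IsSixVertex, sigmaFF, sixV], ?_, by simp [sigmaFF, sixV], ?_⟩
    · simp only [IsFreeFermionic, sigmaFF, sixV, det_fin_two]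
      simp
      field_simp
      ring
    · simpa [sigmaFF, sixV] using hA
  · rintro ⟨h6, hff, h12, h21⟩
    have hdet : (!![R 0 0, R 2 2; -R 1 1, R 3 3]).det = R 1 2 * R 2 1 := by
      rw [det_fin_two_of]
      unfold IsFreeFermionic at hff
      linear_combination hff
    refine ⟨(GeneralLinearGroup.mkOfDetNeZero !![R 0 0, R 2 2; -R 1 1, R 3 3]
      (hdet ▸ mul_ne_zero h12 h21), Units.mk0 _ h12), ?_⟩
    refine Eq.trans ?_ (Eq.symm h6)
    simp [sigmaFF, GeneralLinearGroup.mkOfDetNeZero, hdet, h12]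

set_option maxHeartbeats 4000000 in
lemma ybc_sigmaFF (g h : Matrix.GeneralLinearGroup (Fin 2) ℂ × ℂˣ) :
    ybc (sigmaFF g) (sigmaFF (g * h)) (sigmaFF h) = 0 := by
  obtain ⟨A, u⟩ := g
  obtain ⟨B, v⟩ := h
  have hu : (u : ℂ) ≠ 0 := u.ne_zero
  have hv : (v : ℂ) ≠ 0 := v.ne_zero
  simp only [sigmaFF, Prod.mk_mul_mk, Units.val_mul, det_mul, mul_apply, Fin.sum_univ_two,
    det_fin_two]
  generalize (A : Matrix (Fin 2) (Fin 2) ℂ) = A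
  generalize (B : Matrix (Fin 2) (Fin 2) ℂ) = B
  generalize (u : ℂ) = u at *
  generalize (v : ℂ) = v at *
  ext ⟨i, j, k⟩ ⟨l, m, n⟩
  fin_cases i <;> fin_cases j <;> fin_cases k <;> fin_cases l <;> fin_cases m <;> fin_cases n <;>
    simp [ybc, m12, m13, m23, mul_apply, Fintype.sum_prod_type, idx, sixV] <;>
    field_simp <;> ring

theorem stmt3 :
    Function.Injective sigmaFF ∧
    Set.range sigmaFF
      = {R : M4 | IsSixVertex R ∧ IsFreeFermionic R ∧ R 1 2 ≠ 0 ∧ R 2 1 ≠ 0} ∧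
    (∀ g h : Matrix.GeneralLinearGroup (Fin 2) ℂ × ℂˣ,
      ybc (sigmaFF g) (sigmaFF (g * h)) (sigmaFF h) = 0) :=
  ⟨sigmaFF_injective, range_sigmaFF, ybc_sigmaFF⟩
end
end

section
/- For all z_i, t_i, z_j, t_j ∈ ℂ, the star-triangle relation for Gamma ice holds: ⟦R_ΓΓ(z_i,t_i,z_j,t_j), Γ(z_i,t_i), Γ(z_j,t_j)⟧ = 0. -/
open Matrix

noncomputable section

/-- Gamma ice Boltzmann weight matrix. -/
def GammaM (z t : ℂ) : M4 :=
  !![1, 0, 0, 0; 0, t, (t + 1) * z, 0; 0, 1, z, 0; 0, 0, 0, z]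

/-- Delta ice Boltzmann weight matrix. -/
def DeltaM (z t : ℂ) : M4 :=
  !![z, 0, 0, 1; 0, z * t, 0, 0; 0, 0, 1, 0; z * (t + 1), 0, 0, 1]

/-- Gamma-Gamma R-matrix. -/
def RGG (z₁ t₁ z₂ t₂ : ℂ) : M4 :=
  !![t₂ * z₁ + z₂, 0, 0, 0;
     0, t₁ * z₂ - t₂ * z₁, (t₁ + 1) * z₁, 0;
     0, (t₂ + 1) * z₂, z₁ - z₂, 0;
     0, 0, 0, z₁ + t₁ * z₂]

/-- Delta-Delta R-matrix. -/
def RDD (z₁ t₁ z₂ t₂ : ℂ) : M4 :=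
  !![t₁ * z₁ + z₂, 0, 0, 0;
     0, z₁ - z₂, (t₂ + 1) * z₂, 0;
     0, (t₁ + 1) * z₁, t₂ * z₂ - t₁ * z₁, 0;
     0, 0, 0, t₂ * z₂ + z₁]

/-- Gamma-Delta R-matrix. -/
def RGD (z₁ t₁ z₂ t₂ : ℂ) : M4 :=
  !![t₁ * t₂ * z₂ - z₁, 0, 0, (t₁ + 1) * z₁;
     0, t₂ * z₂ + z₁, 0, 0;
     0, 0, t₁ * z₂ + z₁, 0;
     (t₂ + 1) * z₂, 0, 0, z₁ - z₂]

/-- Delta-Gamma R-matrix. -/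
def RDG (z₁ t₁ z₂ t₂ : ℂ) : M4 :=
  !![z₁ - z₂, 0, 0, (t₂ + 1) * z₂;
     0, t₁ * z₁ + z₂, 0, 0;
     0, 0, t₂ * z₁ + z₂, 0;
     (t₁ + 1) * z₁, 0, 0, z₂ - t₁ * t₂ * z₁]

set_option maxHeartbeats 2000000 in
theorem stmt4 (zi ti zj tj : ℂ) :
    ybc (RGG zi ti zj tj) (GammaM zi ti) (GammaM zj tj) = 0 := by
  ext ⟨a, b, c⟩ ⟨d, e, f⟩
  simp only [ybc, Matrix.sub_apply, Matrix.mul_apply, Fintype.sum_prod_type, Fin.sum_univ_two,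
    m12, m13, m23, Matrix.of_apply, Matrix.zero_apply]
  fin_cases a <;> fin_cases b <;> fin_cases c <;> fin_cases d <;> fin_cases e <;> fin_cases f <;>
    simp [idx, RGG, GammaM] <;> ring
end
end

section
/- Let R be of free-fermionic type C and T of free-fermionic type D, with a₁(R)a₂(R)+b₁(R)b₂(R) ≠ 0 and a₁(T)a₂(T)+b₁(T)b₂(T) ≠ 0. Let S be the R-matrix with a₁(S) = a₂(R)a₁(T)+b₁(R)b₁(T), a₂(S) = a₁(R)a₂(T)+b₂(R)b₂(T), b₁(S) = a₁(R)b₁(T)−b₂(R)a₁(T), b₂(S) = a₂(R)b₂(T)−b₁(R)a₂(T), c₁(S) = c₂(S) = 0, d₁(S) = c₁(R)d₁(T), d₂(S) = c₂(R)d₂(T). Then ⟦R,S,T⟧ = 0 and S is of free-fermionic type D. -/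
open Matrix

noncomputable section

set_option maxHeartbeats 4000000 in
theorem stmt6
    (ra₁ ra₂ rb₁ rb₂ rc₁ rc₂ ta₁ ta₂ tb₁ tb₂ td₁ td₂ : ℂ)
    (hRff : ra₁ * ra₂ + rb₁ * rb₂ = rc₁ * rc₂)
    (hRne : ra₁ * ra₂ + rb₁ * rb₂ ≠ 0)
    (hTff : ta₁ * ta₂ + tb₁ * tb₂ = td₁ * td₂)
    (hTne : ta₁ * ta₂ + tb₁ * tb₂ ≠ 0) :
    ybc (rmat ra₁ ra₂ rb₁ rb₂ rc₁ rc₂ 0 0)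
        (rmat (ra₂ * ta₁ + rb₁ * tb₁) (ra₁ * ta₂ + rb₂ * tb₂)
              (ra₁ * tb₁ - rb₂ * ta₁) (ra₂ * tb₂ - rb₁ * ta₂)
              0 0 (rc₁ * td₁) (rc₂ * td₂))
        (rmat ta₁ ta₂ tb₁ tb₂ 0 0 td₁ td₂) = 0 ∧
    (ra₂ * ta₁ + rb₁ * tb₁) * (ra₁ * ta₂ + rb₂ * tb₂)
      + (ra₁ * tb₁ - rb₂ * ta₁) * (ra₂ * tb₂ - rb₁ * ta₂)
      = (rc₁ * td₁) * (rc₂ * td₂) := by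
  constructor
  · ext ⟨i, j, k⟩ ⟨i', j', k'⟩
    fin_cases i <;> fin_cases j <;> fin_cases k <;>
      fin_cases i' <;> fin_cases j' <;> fin_cases k' <;>
      simp [ybc, m12, m13, m23, rmat, idx, Matrix.mul_apply, Fintype.sum_prod_type] <;>
      grind
  · linear_combination (ta₁ * ta₂ + tb₁ * tb₂) * hRff + rc₁ * rc₂ * hTff
end
end

section
/- For all z_i, t_i, z_j, t_j ∈ ℂ, the mixed star-triangle relation for Gamma-Delta ice holds: ⟦R_ΓΔ(z_i,t_i,z_j,t_j), Γ(z_i,t_i), Δ(z_j,t_j)⟧ = 0. -/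
open Matrix

noncomputable section

set_option maxHeartbeats 4000000 in
theorem stmt10 (zi ti zj tj : ℂ) :
    ybc (RGD zi ti zj tj) (GammaM zi ti) (DeltaM zj tj) = 0 := by
  ext ⟨a, b, c⟩ ⟨d, e, f⟩
  fin_cases a <;> fin_cases b <;> fin_cases c <;> fin_cases d <;> fin_cases e <;> fin_cases f <;>
    simp [ybc, m12, m13, m23, idx, RGD, GammaM, DeltaM, Matrix.mul_apply, Fintype.sum_prod_type] <;>
    ring
end
end

section
/- For all z_i, t_i, z_j, t_j ∈ ℂ, the mixed star-triangle relation for Delta-Gamma ice holds: ⟦R_ΔΓ(z_i,t_i,z_j,t_j), Δ(z_i,t_i), Γ(z_j,t_j)⟧ = 0. -/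
open Matrix

noncomputable section

set_option maxHeartbeats 4000000 in
theorem stmt11 (zi ti zj tj : ℂ) :
    ybc (RDG zi ti zj tj) (DeltaM zi ti) (GammaM zj tj) = 0 := by
  ext ⟨a, b, c⟩ ⟨d, e, f⟩
  simp only [ybc, Matrix.sub_apply, Matrix.mul_apply, Fintype.sum_prod_type, Fin.sum_univ_two,
    m12, m13, m23, Matrix.of_apply, Matrix.zero_apply]
  fin_cases a <;> fin_cases b <;> fin_cases c <;> fin_cases d <;> fin_cases e <;> fin_cases f <;>
    simp [idx, RDG, DeltaM, GammaM] <;> ring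
end
end

section
/- For all choices of types X, Y, Z ∈ {Γ, Δ} and all z₁, t₁, z₂, t₂, z₃, t₃ ∈ ℂ: ⟦R_{XY}(z₁,t₁,z₂,t₂), R_{XZ}(z₁,t₁,z₃,t₃), R_{YZ}(z₂,t₂,z₃,t₃)⟧ = 0. -/
open Matrix

noncomputable section

/-- The two types of ice, Gamma and Delta. -/
inductive IceType
  | Gamma : IceType
  | Delta : IceType

/-- The R-matrix `R_{XY}` for types `X, Y ∈ {Γ, Δ}`. -/
def Rice : IceType → IceType → ℂ → ℂ → ℂ → ℂ → M4
  | .Gamma, .Gamma => RGG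
  | .Gamma, .Delta => RGD
  | .Delta, .Gamma => RDG
  | .Delta, .Delta => RDD

theorem idx_eq : idx 0 0 = 0 ∧ idx 0 1 = 1 ∧ idx 1 0 = 2 ∧ idx 1 1 = 3 :=
  ⟨rfl, rfl, rfl, rfl⟩

/-- The eight-vertex condition: `R` preserves the parity of the number of `v₋` factors. -/
def PreservesParity (R : M4) : Prop :=
  R 0 1 = 0 ∧ R 0 2 = 0 ∧ R 1 0 = 0 ∧ R 1 3 = 0 ∧
    R 2 0 = 0 ∧ R 2 3 = 0 ∧ R 3 1 = 0 ∧ R 3 2 = 0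

theorem Rice_preservesParity (X Y : IceType) (z₁ t₁ z₂ t₂ : ℂ) :
    PreservesParity (Rice X Y z₁ t₁ z₂ t₂) := by
  cases X <;> cases Y <;> simp [PreservesParity, Rice, RGG, RGD, RDG, RDD]

set_option maxHeartbeats 4000000 in
theorem stmt12 (X Y Z : IceType) (z₁ t₁ z₂ t₂ z₃ t₃ : ℂ) :
    ybc (Rice X Y z₁ t₁ z₂ t₂) (Rice X Z z₁ t₁ z₃ t₃) (Rice Y Z z₂ t₂ z₃ t₃) = 0 := by
  have hR := Rice_preservesParity X Y z₁ t₁ z₂ t₂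
  have hS := Rice_preservesParity X Z z₁ t₁ z₃ t₃
  have hT := Rice_preservesParity Y Z z₂ t₂ z₃ t₃
  simp only [PreservesParity] at hR hS hT
  ext ⟨i₁, i₂, i₃⟩ ⟨j₁, j₂, j₃⟩
  simp only [ybc, m12, m13, m23, Matrix.sub_apply, Matrix.mul_apply, Fintype.sum_prod_type,
    Fin.sum_univ_two, Matrix.of_apply, Matrix.zero_apply]
  revert i₁ i₂ i₃ j₁ j₂ j₃
  simp only [Fin.forall_fin_two, idx_eq, hR, hS, hT, if_true, if_false, zero_ne_one, one_ne_zero,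
    mul_zero, zero_mul, mul_one, one_mul, add_zero, zero_add, sub_zero, true_and, and_true]
  clear hR hS hT
  cases X <;> cases Y <;> cases Z <;>
    simp only [Rice, RGG, RGD, RDG, RDD, Matrix.of_apply, Matrix.cons_val, mul_zero, zero_mul,
      add_zero, zero_add, sub_zero, true_and, and_true] <;>
    and_intros <;> ring
end
end

section
/- For all choices of types X, Y, Z ∈ {Γ, Δ} and all z₁, t₁, z₂, t₂, z₃, t₃ ∈ ℂ: ⟦R_{XY}(z₂,t₁,z₁,t₂), R_{XZ}(z₃,t₁,z₁,t₃), R_{YZ}(z₃,t₂,z₂,t₃)⟧ = 0. -/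
open Matrix

noncomputable section

theorem m12_mul_m13_mul_m23_apply (R S T : M4) (a b c d e f : Fin 2) :
    (m12 R * m13 S * m23 T) (a, b, c) (d, e, f) =
      ∑ i, ∑ j, ∑ k, R (idx a b) (idx i j) * S (idx i c) (idx d k) * T (idx j k) (idx e f) := by
  simp [m12, m13, m23, Matrix.mul_apply, Fintype.sum_prod_type]
  fin_cases c <;> fin_cases d <;> simp <;> ring

theorem m23_mul_m13_mul_m12_apply (R S T : M4) (a b c d e f : Fin 2) :
    (m23 T * m13 S * m12 R) (a, b, c) (d, e, f) =
      ∑ i, ∑ j, ∑ k, T (idx b c) (idx j k) * S (idx a k) (idx i f) * R (idx i j) (idx d e) := by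
  simp [m12, m13, m23, Matrix.mul_apply, Fintype.sum_prod_type]
  fin_cases a <;> fin_cases f <;> simp <;> ring

theorem idx_zero_zero : idx 0 0 = 0 := rfl

theorem idx_zero_one : idx 0 1 = 1 := rfl

theorem idx_one_zero : idx 1 0 = 2 := rfl

theorem idx_one_one : idx 1 1 = 3 := rfl

theorem Rice_zero_one (X Y : IceType) (z₁ t₁ z₂ t₂ : ℂ) :
    Rice X Y z₁ t₁ z₂ t₂ 0 1 = 0 := by
  cases X <;> cases Y <;> rfl

theorem Rice_zero_two (X Y : IceType) (z₁ t₁ z₂ t₂ : ℂ) :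
    Rice X Y z₁ t₁ z₂ t₂ 0 2 = 0 := by
  cases X <;> cases Y <;> rfl

theorem Rice_one_zero (X Y : IceType) (z₁ t₁ z₂ t₂ : ℂ) :
    Rice X Y z₁ t₁ z₂ t₂ 1 0 = 0 := by
  cases X <;> cases Y <;> rfl

theorem Rice_one_three (X Y : IceType) (z₁ t₁ z₂ t₂ : ℂ) :
    Rice X Y z₁ t₁ z₂ t₂ 1 3 = 0 := by
  cases X <;> cases Y <;> rfl

theorem Rice_two_zero (X Y : IceType) (z₁ t₁ z₂ t₂ : ℂ) :
    Rice X Y z₁ t₁ z₂ t₂ 2 0 = 0 := by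
  cases X <;> cases Y <;> rfl

theorem Rice_two_three (X Y : IceType) (z₁ t₁ z₂ t₂ : ℂ) :
    Rice X Y z₁ t₁ z₂ t₂ 2 3 = 0 := by
  cases X <;> cases Y <;> rfl

theorem Rice_three_one (X Y : IceType) (z₁ t₁ z₂ t₂ : ℂ) :
    Rice X Y z₁ t₁ z₂ t₂ 3 1 = 0 := by
  cases X <;> cases Y <;> rfl

theorem Rice_three_two (X Y : IceType) (z₁ t₁ z₂ t₂ : ℂ) :
    Rice X Y z₁ t₁ z₂ t₂ 3 2 = 0 := by
  cases X <;> cases Y <;> rfl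

set_option maxHeartbeats 4000000 in
theorem stmt13 (X Y Z : IceType) (z₁ t₁ z₂ t₂ z₃ t₃ : ℂ) :
    ybc (Rice X Y z₂ t₁ z₁ t₂) (Rice X Z z₃ t₁ z₁ t₃) (Rice Y Z z₃ t₂ z₂ t₃) = 0 := by
  ext ⟨a, b, c⟩ ⟨d, e, f⟩
  rw [ybc, Matrix.sub_apply, m12_mul_m13_mul_m23_apply, m23_mul_m13_mul_m12_apply,
    Matrix.zero_apply]
  simp only [Fin.sum_univ_two]
  fin_cases a <;> fin_cases b <;> fin_cases c <;>
    fin_cases d <;> fin_cases e <;> fin_cases f <;>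
    simp only [Fin.zero_eta, Fin.mk_one, idx_zero_zero, idx_zero_one, idx_one_zero, idx_one_one,
      Rice_zero_one, Rice_zero_two, Rice_one_zero, Rice_one_three, Rice_two_zero, Rice_two_three,
      Rice_three_one, Rice_three_two, mul_zero, zero_mul, add_zero, zero_add, sub_zero] <;>
    cases X <;> cases Y <;> cases Z <;>
    simp [Rice, RGG, RDD, RGD, RDG] <;>
    ring
end
end

section
/- Fix types X, Y ∈ {Γ, Δ} and define R̂_{XY}(z₁,t₁,z₂,t₂) = R_{XY}(z₂,t₁,z₁,t₂). Set A = R̂_{XX}, C = R̂_{XY}, B = C‡ and D = (R̂_{YY})‡. Then for all complex parameter points p₁=(z₁,t₁), p₂=(z₂,t₂), p₃=(z₃,t₃), all eight Yang–Baxter system relations hold: [A,A,A] = [D,D,D] = [A,C,C] = [D,B,B] = [A,B‡,B‡] = [D,C‡,C‡] = [A,C,B‡] = [D,B,C‡] = 0. -/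
open Matrix

noncomputable section

/-- The flip matrix `P` on `V ⊗ V`. -/
def Pmat : M4 := !![1, 0, 0, 0; 0, 0, 1, 0; 0, 1, 0, 0; 0, 0, 0, 1]

/-- `R_{XY}` as a function of two parameter points `(z, t)`. -/
def RiceP (X Y : IceType) (p q : ℂ × ℂ) : M4 := Rice X Y p.1 p.2 q.1 q.2

/-- The involution `U ↦ U‡`, `U‡(p₁,p₂) = P · U(p₂,p₁) · P`. -/
def ddag (U : ℂ × ℂ → ℂ × ℂ → M4) (p q : ℂ × ℂ) : M4 := Pmat * U q p * Pmat

/-- The parametrized Yang–Baxter system bracket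
`[U,V,W] = U(p₁,p₂)₁₂ V(p₁,p₃)₁₃ W(p₂,p₃)₂₃ − W(p₂,p₃)₂₃ V(p₁,p₃)₁₃ U(p₁,p₂)₁₂`. -/
def ybs (U V W : ℂ × ℂ → ℂ × ℂ → M4) (p₁ p₂ p₃ : ℂ × ℂ) : M8 :=
  m12 (U p₁ p₂) * m13 (V p₁ p₃) * m23 (W p₂ p₃)
    - m23 (W p₂ p₃) * m13 (V p₁ p₃) * m12 (U p₁ p₂)

/-- `R̂_{XY}(z₁,t₁,z₂,t₂) = R_{XY}(z₂,t₁,z₁,t₂)`, as a function of two parameter points. -/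
def RhatP (X Y : IceType) (p q : ℂ × ℂ) : M4 := Rice X Y q.1 p.2 p.1 q.2

/-- Conjugation by the flip exchanges the two middle basis vectors. -/
theorem Pmat_mul_mul_Pmat (a₁ a₂ b₁ b₂ c₁ c₂ d₁ d₂ : ℂ) :
    Pmat * rmat a₁ a₂ b₁ b₂ c₁ c₂ d₁ d₂ * Pmat = rmat a₁ a₂ b₂ b₁ c₂ c₁ d₁ d₂ := by
  ext i j
  fin_cases i <;> fin_cases j <;>
    simp [Pmat, rmat, Matrix.mul_apply, Fin.sum_univ_four]

theorem Pmat_mul_Pmat : Pmat * Pmat = 1 := by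
  ext i j
  fin_cases i <;> fin_cases j <;> simp [Pmat, Matrix.mul_apply, Fin.sum_univ_four]

theorem ddag_ddag (U : ℂ × ℂ → ℂ × ℂ → M4) : ddag (ddag U) = U := by
  funext p q
  calc Pmat * (Pmat * U p q * Pmat) * Pmat = (Pmat * Pmat) * U p q * (Pmat * Pmat) := by
        simp only [Matrix.mul_assoc]
    _ = U p q := by simp only [Pmat_mul_Pmat, Matrix.one_mul, Matrix.mul_one]

theorem RGG_eq_rmat (z₁ t₁ z₂ t₂ : ℂ) :
    RGG z₁ t₁ z₂ t₂ = rmat (t₂ * z₁ + z₂) (z₁ + t₁ * z₂) (t₁ * z₂ - t₂ * z₁) (z₁ - z₂)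
      ((t₁ + 1) * z₁) ((t₂ + 1) * z₂) 0 0 := rfl

theorem RDD_eq_rmat (z₁ t₁ z₂ t₂ : ℂ) :
    RDD z₁ t₁ z₂ t₂ = rmat (t₁ * z₁ + z₂) (t₂ * z₂ + z₁) (z₁ - z₂) (t₂ * z₂ - t₁ * z₁)
      ((t₂ + 1) * z₂) ((t₁ + 1) * z₁) 0 0 := rfl

theorem RGD_eq_rmat (z₁ t₁ z₂ t₂ : ℂ) :
    RGD z₁ t₁ z₂ t₂ = rmat (t₁ * t₂ * z₂ - z₁) (z₁ - z₂) (t₂ * z₂ + z₁) (t₁ * z₂ + z₁)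
      0 0 ((t₁ + 1) * z₁) ((t₂ + 1) * z₂) := rfl

theorem RDG_eq_rmat (z₁ t₁ z₂ t₂ : ℂ) :
    RDG z₁ t₁ z₂ t₂ = rmat (z₁ - z₂) (z₂ - t₁ * t₂ * z₁) (t₁ * z₁ + z₂) (t₂ * z₁ + z₂)
      0 0 ((t₂ + 1) * z₂) ((t₁ + 1) * z₁) := rfl

theorem rmat_idx (a₁ a₂ b₁ b₂ c₁ c₂ d₁ d₂ : ℂ) (i j k l : Fin 2) :
    rmat a₁ a₂ b₁ b₂ c₁ c₂ d₁ d₂ (idx i j) (idx k l) =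
      ![![![![a₁, 0], ![0, d₁]], ![![0, b₁], ![c₁, 0]]],
        ![![![0, c₂], ![b₂, 0]], ![![d₂, 0], ![0, a₂]]]] i j k l := by
  fin_cases i <;> fin_cases j <;> fin_cases k <;> fin_cases l <;> rfl

set_option maxHeartbeats 4000000 in
/-- The matrix Yang–Baxter equation for eight-vertex matrices follows from the polynomial equations
between their weights. -/
theorem ybc_rmat_eq_zero {a₁ a₂ b₁ b₂ c₁ c₂ d₁ d₂ a₁' a₂' b₁' b₂' c₁' c₂' d₁' d₂'
    a₁'' a₂'' b₁'' b₂'' c₁'' c₂'' d₁'' d₂'' : ℂ}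
    (_ : a₁ * a₁' * a₁'' + d₁ * c₂' * d₂'' = a₁'' * a₁' * a₁ + d₁'' * c₁' * d₂)
    (_ : a₁ * a₁' * d₁'' + d₁ * c₂' * a₂'' = d₁'' * b₁' * b₁ + a₁'' * d₁' * c₂)
    (_ : a₁ * d₁' * b₁'' + d₁ * b₂' * c₂'' = d₁'' * b₁' * c₁ + a₁'' * d₁' * b₂)
    (_ : a₁ * d₁' * c₁'' + d₁ * b₂' * b₂'' = a₁'' * a₁' * d₁ + d₁'' * c₁' * a₂)
    (_ : a₁ * b₁' * b₁'' + d₁ * d₂' * c₂'' = b₁'' * b₁' * a₁ + c₁'' * d₁' * d₂)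
    (_ : a₁ * b₁' * c₁'' + d₁ * d₂' * b₂'' = c₁'' * a₁' * b₁ + b₁'' * c₁' * c₂)
    (_ : a₁ * c₁' * a₁'' + d₁ * a₂' * d₂'' = c₁'' * a₁' * c₁ + b₁'' * c₁' * b₂)
    (_ : a₁ * c₁' * d₁'' + d₁ * a₂' * a₂'' = b₁'' * b₁' * d₁ + c₁'' * d₁' * a₂)
    (_ : c₁ * c₂' * b₁'' + b₁ * a₁' * c₂'' = c₂'' * b₁' * a₁ + b₂'' * d₁' * d₂)
    (_ : c₁ * c₂' * c₁'' + b₁ * a₁' * b₂'' = b₂'' * a₁' * b₁ + c₂'' * c₁' * c₂)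
    (_ : c₁ * b₂' * a₁'' + b₁ * d₁' * d₂'' = b₂'' * a₁' * c₁ + c₂'' * c₁' * b₂)
    (_ : c₁ * b₂' * d₁'' + b₁ * d₁' * a₂'' = c₂'' * b₁' * d₁ + b₂'' * d₁' * a₂)
    (_ : c₁ * d₂' * a₁'' + b₁ * b₁' * d₂'' = d₂'' * a₁' * a₁ + a₂'' * c₁' * d₂)
    (_ : c₁ * d₂' * d₁'' + b₁ * b₁' * a₂'' = a₂'' * b₁' * b₁ + d₂'' * d₁' * c₂)
    (_ : c₁ * a₂' * b₁'' + b₁ * c₁' * c₂'' = a₂'' * b₁' * c₁ + d₂'' * d₁' * b₂)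
    (_ : c₁ * a₂' * c₁'' + b₁ * c₁' * b₂'' = d₂'' * a₁' * d₁ + a₂'' * c₁' * a₂)
    (_ : b₂ * c₂' * b₁'' + c₂ * a₁' * c₂'' = a₁'' * c₂' * a₁ + d₁'' * a₂' * d₂)
    (_ : b₂ * c₂' * c₁'' + c₂ * a₁' * b₂'' = d₁'' * d₂' * b₁ + a₁'' * b₂' * c₂)
    (_ : b₂ * b₂' * a₁'' + c₂ * d₁' * d₂'' = d₁'' * d₂' * c₁ + a₁'' * b₂' * b₂)
    (_ : b₂ * b₂' * d₁'' + c₂ * d₁' * a₂'' = a₁'' * c₂' * d₁ + d₁'' * a₂' * a₂)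
    (_ : b₂ * d₂' * a₁'' + c₂ * b₁' * d₂'' = b₁'' * d₂' * a₁ + c₁'' * b₂' * d₂)
    (_ : b₂ * d₂' * d₁'' + c₂ * b₁' * a₂'' = c₁'' * c₂' * b₁ + b₁'' * a₂' * c₂)
    (_ : b₂ * a₂' * b₁'' + c₂ * c₁' * c₂'' = c₁'' * c₂' * c₁ + b₁'' * a₂' * b₂)
    (_ : b₂ * a₂' * c₁'' + c₂ * c₁' * b₂'' = b₁'' * d₂' * d₁ + c₁'' * b₂' * a₂)
    (_ : d₂ * a₁' * a₁'' + a₂ * c₂' * d₂'' = c₂'' * d₂' * a₁ + b₂'' * b₂' * d₂)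
    (_ : d₂ * a₁' * d₁'' + a₂ * c₂' * a₂'' = b₂'' * c₂' * b₁ + c₂'' * a₂' * c₂)
    (_ : d₂ * d₁' * b₁'' + a₂ * b₂' * c₂'' = b₂'' * c₂' * c₁ + c₂'' * a₂' * b₂)
    (_ : d₂ * d₁' * c₁'' + a₂ * b₂' * b₂'' = c₂'' * d₂' * d₁ + b₂'' * b₂' * a₂)
    (_ : d₂ * b₁' * b₁'' + a₂ * d₂' * c₂'' = d₂'' * c₂' * a₁ + a₂'' * a₂' * d₂)
    (_ : d₂ * b₁' * c₁'' + a₂ * d₂' * b₂'' = a₂'' * d₂' * b₁ + d₂'' * b₂' * c₂)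
    (_ : d₂ * c₁' * a₁'' + a₂ * a₂' * d₂'' = a₂'' * d₂' * c₁ + d₂'' * b₂' * b₂)
    (_ : d₂ * c₁' * d₁'' + a₂ * a₂' * a₂'' = d₂'' * c₂' * d₁ + a₂'' * a₂' * a₂) :
    ybc (rmat a₁ a₂ b₁ b₂ c₁ c₂ d₁ d₂) (rmat a₁' a₂' b₁' b₂' c₁' c₂' d₁' d₂')
      (rmat a₁'' a₂'' b₁'' b₂'' c₁'' c₂'' d₁'' d₂'') = 0 := by
  ext ⟨i, j, k⟩ ⟨l, m, n⟩
  fin_cases i <;> fin_cases j <;> fin_cases k <;> fin_cases l <;> fin_cases m <;>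
    fin_cases n <;>
    simp [ybc, m12, m13, m23, Matrix.mul_apply, Fintype.sum_prod_type, rmat_idx] <;>
    exact sub_eq_zero.2 (by assumption)

theorem ybs_eq_ybc (U V W : ℂ × ℂ → ℂ × ℂ → M4) (p₁ p₂ p₃ : ℂ × ℂ) :
    ybs U V W p₁ p₂ p₃ = ybc (U p₁ p₂) (V p₁ p₃) (W p₂ p₃) := rfl

set_option maxHeartbeats 4000000 in
theorem ybs_RhatP (X Y : IceType) (p₁ p₂ p₃ : ℂ × ℂ) :
    ybs (RhatP X X) (RhatP X Y) (RhatP X Y) p₁ p₂ p₃ = 0 := by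
  cases X <;> cases Y <;>
    simp only [ybs_eq_ybc, RhatP, Rice, RGG_eq_rmat, RDD_eq_rmat, RGD_eq_rmat, RDG_eq_rmat] <;>
    apply ybc_rmat_eq_zero <;> ring

set_option maxHeartbeats 4000000 in
theorem ybs_ddag_RhatP (X Y : IceType) (p₁ p₂ p₃ : ℂ × ℂ) :
    ybs (ddag (RhatP Y Y)) (ddag (RhatP X Y)) (ddag (RhatP X Y)) p₁ p₂ p₃ = 0 := by
  cases X <;> cases Y <;>
    simp only [ybs_eq_ybc, ddag, RhatP, Rice, RGG_eq_rmat, RDD_eq_rmat, RGD_eq_rmat,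
      RDG_eq_rmat, Pmat_mul_mul_Pmat] <;>
    apply ybc_rmat_eq_zero <;> ring

theorem stmt15 (X Y : IceType) (p₁ p₂ p₃ : ℂ × ℂ) :
    ybs (RhatP X X) (RhatP X X) (RhatP X X) p₁ p₂ p₃ = 0 ∧
    ybs (ddag (RhatP Y Y)) (ddag (RhatP Y Y)) (ddag (RhatP Y Y)) p₁ p₂ p₃ = 0 ∧
    ybs (RhatP X X) (RhatP X Y) (RhatP X Y) p₁ p₂ p₃ = 0 ∧
    ybs (ddag (RhatP Y Y)) (ddag (RhatP X Y)) (ddag (RhatP X Y)) p₁ p₂ p₃ = 0 ∧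
    ybs (RhatP X X) (ddag (ddag (RhatP X Y))) (ddag (ddag (RhatP X Y))) p₁ p₂ p₃ = 0 ∧
    ybs (ddag (RhatP Y Y)) (ddag (RhatP X Y)) (ddag (RhatP X Y)) p₁ p₂ p₃ = 0 ∧
    ybs (RhatP X X) (RhatP X Y) (ddag (ddag (RhatP X Y))) p₁ p₂ p₃ = 0 ∧
    ybs (ddag (RhatP Y Y)) (ddag (RhatP X Y)) (ddag (RhatP X Y)) p₁ p₂ p₃ = 0 := by
  simp only [ddag_ddag]
  exact ⟨ybs_RhatP X X p₁ p₂ p₃, ybs_ddag_RhatP Y Y p₁ p₂ p₃, ybs_RhatP X Y p₁ p₂ p₃,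
    ybs_ddag_RhatP X Y p₁ p₂ p₃, ybs_RhatP X Y p₁ p₂ p₃, ybs_ddag_RhatP X Y p₁ p₂ p₃,
    ybs_RhatP X Y p₁ p₂ p₃, ybs_ddag_RhatP X Y p₁ p₂ p₃⟩
end
end

section
/- (Tokuyama's theorem.) For every n ≥ 1 and every partition λ with at most n parts, the following identity of polynomials in z₁,…,z_n and t holds: ( Σ_{𝔗 ∈ GT(λ)} (∏_{k=1}^n z_k^{d_k(𝔗)−d_{k+1}(𝔗)}) · t^{l(𝔗)} · (t+1)^{s(𝔗)} ) · ∏_{1≤i<j≤n} (z_i − z_j) = ∏_{1≤i<j≤n} (z_i + t z_j) · det( z_i^{λ_j + n − j} )_{1≤i,j≤n}. (Equivalently, the left-hand sum equals ∏_{i<j}(z_i + t z_j) times the Schur polynomial s_λ(z₁,…,z_n).) -/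
open Finset

noncomputable section

/-- The sum `d_k(𝔗)` of the `k`-th row (0-indexed) of the triangular array `T`;
entries outside the triangle vanish, so summing over `range n` suffices. -/
def rowSum (n : ℕ) (T : ℕ → ℕ → ℤ) (k : ℕ) : ℤ := ∑ j ∈ Finset.range n, T k j

/-- `T` encodes a strict Gelfand–Tsetlin pattern with `n` rows (rows `0,…,n−1`, row `k`
having entries in columns `k,…,n−1`) with top row `T 0 j = λ_j + (n − 1 − j)`, where all
values outside the triangle are `0`. The conditions are: interleaving
`T k (j−1) ≥ T (k+1) j ≥ T k j` and strict decrease along each row. -/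
def IsGT (n : ℕ) (lam : ℕ → ℕ) (T : ℕ → ℕ → ℤ) : Prop :=
  (∀ k j : ℕ, ¬(k ≤ j ∧ j < n) → T k j = 0) ∧
  (∀ j : ℕ, j < n → T 0 j = (lam j : ℤ) + (n : ℤ) - 1 - (j : ℤ)) ∧
  (∀ k j : ℕ, k + 1 ≤ j → j < n →
    T k (j - 1) ≥ T (k + 1) j ∧ T (k + 1) j ≥ T k j) ∧
  (∀ k j : ℕ, k ≤ j → j + 1 < n → T k j > T k (j + 1))

/-- The total number of left-leaning entries of the pattern:
entries `T k j` (`1 ≤ k ≤ j < n`) with `T k j = T (k−1) (j−1)`. -/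
def leftCount (n : ℕ) (T : ℕ → ℕ → ℤ) : ℕ :=
  ((Finset.range n ×ˢ Finset.range n).filter
    (fun p => 1 ≤ p.1 ∧ p.1 ≤ p.2 ∧ T p.1 p.2 = T (p.1 - 1) (p.2 - 1))).card

/-- The total number of special entries of the pattern:
entries `T k j` (`1 ≤ k ≤ j < n`) that are neither left- nor right-leaning. -/
def specialCount (n : ℕ) (T : ℕ → ℕ → ℤ) : ℕ :=
  ((Finset.range n ×ˢ Finset.range n).filter
    (fun p => 1 ≤ p.1 ∧ p.1 ≤ p.2 ∧ T p.1 p.2 ≠ T (p.1 - 1) (p.2 - 1)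
      ∧ T p.1 p.2 ≠ T (p.1 - 1) p.2)).card

/-- The number `l_r(𝔗)` of left-leaning entries in row `r` (0-indexed, `r ≥ 1`). -/
def leftRow (n r : ℕ) (T : ℕ → ℕ → ℤ) : ℕ :=
  ((Finset.range n).filter
    (fun j => r ≤ j ∧ T r j = T (r - 1) (j - 1))).card

/-- The number `s_r(𝔗)` of special entries in row `r` (0-indexed, `r ≥ 1`). -/
def specialRow (n r : ℕ) (T : ℕ → ℕ → ℤ) : ℕ :=
  ((Finset.range n).filter
    (fun j => r ≤ j ∧ T r j ≠ T (r - 1) (j - 1) ∧ T r j ≠ T (r - 1) j)).card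

/-- The partition function `Z_λ(z₁,…,z_n; t₁,…,t_n)` of the Gamma ice model, written as a
sum over strict Gelfand–Tsetlin patterns with top row `λ + ρ`. -/
def Zice (n : ℕ) (lam : ℕ → ℕ) (z t : ℕ → ℂ) : ℂ :=
  ∑ᶠ (T : ℕ → ℕ → ℤ) (_ : IsGT n lam T),
    (∏ k ∈ Finset.range n, z k ^ (rowSum n T k - rowSum n T (k + 1))) *
      ∏ k ∈ Finset.range (n - 1),
        (t k ^ leftRow n (k + 1) T * (t k + 1) ^ specialRow n (k + 1) T)

/-- The contribution of an entry `m` lying below `a` (to its left) and `b` (to its right). -/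
def entryWeight (t : ℂ) (a b m : ℤ) : ℂ :=
  (if m = a then t else 1) * (if m ≠ a ∧ m ≠ b then t + 1 else 1)

/-- The summand attached to a pattern `T` in Tokuyama's formula. -/
def patternWeight (n : ℕ) (z : ℕ → ℂ) (t : ℂ) (T : ℕ → ℕ → ℤ) : ℂ :=
  (∏ k ∈ range n, z k ^ (rowSum n T k - rowSum n T (k + 1))) *
    t ^ leftCount n T * (t + 1) ^ specialCount n T

/-- The strict Gelfand–Tsetlin patterns with `n` rows and top row `ℓ`. -/
def strictPatterns (n : ℕ) (ℓ : Fin n → ℕ) : Set (ℕ → ℕ → ℤ) :=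
  {T | (∀ k j : ℕ, ¬(k ≤ j ∧ j < n) → T k j = 0) ∧
    (∀ j : Fin n, T 0 j = ℓ j) ∧
    (∀ k j : ℕ, k + 1 ≤ j → j < n → T k (j - 1) ≥ T (k + 1) j ∧ T (k + 1) j ≥ T k j) ∧
    (∀ k j : ℕ, k ≤ j → j + 1 < n → T k j > T k (j + 1))}

/-- The array obtained by placing the row `ℓ` on top of the array `T`. -/
def addTopRow (n : ℕ) (ℓ : Fin n → ℕ) (T : ℕ → ℕ → ℤ) : ℕ → ℕ → ℤ
  | 0, j => if h : j < n then (ℓ ⟨j, h⟩ : ℤ) else 0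
  | _ + 1, 0 => 0
  | k + 1, j + 1 => T k j

/-- The rows, not necessarily strict, that interleave with `ℓ`. -/
def interleavingRows {n : ℕ} (ℓ : Fin (n + 1) → ℕ) : Finset (Fin n → ℕ) :=
  Fintype.piFinset fun j => Finset.Icc (ℓ j.succ) (ℓ j.castSucc)

lemma pow_leftCount_mul_pow_specialCount (n : ℕ) (t : ℂ) (T : ℕ → ℕ → ℤ) :
    t ^ leftCount n T * (t + 1) ^ specialCount n T =
      ∏ k ∈ range n, ∏ j ∈ range n,
        if 1 ≤ k ∧ k ≤ j then entryWeight t (T (k - 1) (j - 1)) (T (k - 1) j) (T k j) else 1 := by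
  rw [← Finset.prod_product', leftCount, specialCount, ← Finset.prod_const, ← Finset.prod_const,
    Finset.prod_filter, Finset.prod_filter, ← Finset.prod_mul_distrib]
  refine Finset.prod_congr rfl fun p _ => ?_
  unfold entryWeight
  by_cases h₁ : 1 ≤ p.1 <;> by_cases h₂ : p.1 ≤ p.2 <;> simp [h₁, h₂]

lemma rowSum_addTopRow_succ (n : ℕ) (ℓ : Fin (n + 1) → ℕ) (T : ℕ → ℕ → ℤ) (k : ℕ) :
    rowSum (n + 1) (addTopRow (n + 1) ℓ T) (k + 1) = rowSum n T k := by
  simp [rowSum, Finset.sum_range_succ', addTopRow]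

lemma rowSum_addTopRow_zero (n : ℕ) (ℓ : Fin n → ℕ) (T : ℕ → ℕ → ℤ) :
    rowSum n (addTopRow n ℓ T) 0 = ∑ j, (ℓ j : ℤ) := by
  simp [rowSum, Finset.sum_range, addTopRow]

lemma prod_entryWeight_addTopRow (n : ℕ) (t : ℂ) (ℓ : Fin (n + 1) → ℕ) (T : ℕ → ℕ → ℤ) :
    t ^ leftCount (n + 1) (addTopRow (n + 1) ℓ T) *
        (t + 1) ^ specialCount (n + 1) (addTopRow (n + 1) ℓ T) =
      (∏ j : Fin n, entryWeight t (ℓ j.castSucc) (ℓ j.succ) (T 0 j)) *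
        (t ^ leftCount n T * (t + 1) ^ specialCount n T) := by
  rw [pow_leftCount_mul_pow_specialCount, pow_leftCount_mul_pow_specialCount,
    Finset.prod_range_succ']
  have key : ∀ k ∈ range n, (∏ j ∈ range (n + 1), if 1 ≤ k + 1 ∧ k + 1 ≤ j then
      entryWeight t (addTopRow (n + 1) ℓ T (k + 1 - 1) (j - 1))
        (addTopRow (n + 1) ℓ T (k + 1 - 1) j) (addTopRow (n + 1) ℓ T (k + 1) j) else 1) =
      (if k = 0 then ∏ j : Fin n, entryWeight t (ℓ j.castSucc) (ℓ j.succ) (T 0 j) else 1) *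
      ∏ j ∈ range n, if 1 ≤ k ∧ k ≤ j then
        entryWeight t (T (k - 1) (j - 1)) (T (k - 1) j) (T k j) else 1 := by
    intro k _
    rw [Finset.prod_range_succ']
    cases k with
    | zero =>
      simp only [Finset.prod_range, addTopRow]
      simp only [zero_add, le_refl, Nat.le_add_left, and_self, if_true, Nat.add_sub_cancel,
        Nat.sub_self, nonpos_iff_eq_zero, one_ne_zero, and_false, if_false, mul_one, false_and,
        Finset.prod_const_one]
      refine Finset.prod_congr rfl fun j _ => ?_
      rw [dif_pos (by omega), dif_pos (by omega)]
      rfl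
    | succ k =>
      simp only [Nat.add_sub_cancel, Nat.add_eq_zero_iff, one_ne_zero, and_false, if_false,
        one_mul, nonpos_iff_eq_zero, mul_one]
      refine Finset.prod_congr rfl fun j _ => ?_
      cases j with
      | zero => simp
      | succ j => simp [addTopRow]
  rw [Finset.prod_congr rfl key, Finset.prod_mul_distrib, Finset.prod_ite_eq']
  rcases n with _ | n <;> simp

lemma patternWeight_addTopRow (n : ℕ) (z : ℕ → ℂ) (t : ℂ) (ℓ : Fin (n + 1) → ℕ)
    (T : ℕ → ℕ → ℤ) :
    patternWeight (n + 1) z t (addTopRow (n + 1) ℓ T) =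
      z 0 ^ ((∑ j, (ℓ j : ℤ)) - rowSum n T 0) *
        (∏ j : Fin n, entryWeight t (ℓ j.castSucc) (ℓ j.succ) (T 0 j)) *
        patternWeight n (fun k => z (k + 1)) t T := by
  rw [patternWeight, mul_assoc, prod_entryWeight_addTopRow, patternWeight,
    Finset.prod_range_succ', rowSum_addTopRow_succ, rowSum_addTopRow_zero]
  simp only [rowSum_addTopRow_succ]
  ring

lemma addTopRow_injective (n : ℕ) (ℓ : Fin n → ℕ) : Function.Injective (addTopRow n ℓ) :=
  fun _ _ h => funext₂ fun k j => congrFun₂ h (k + 1) (j + 1)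

lemma strictPatterns_succ {n : ℕ} {ℓ : Fin (n + 1) → ℕ} (hℓ : StrictAnti ℓ) :
    strictPatterns (n + 1) ℓ = ⋃ m ∈ {m | m ∈ interleavingRows ℓ ∧ StrictAnti m},
      addTopRow (n + 1) ℓ '' strictPatterns n m := by
  ext T
  simp only [Set.mem_iUnion, Set.mem_image, exists_prop, Set.mem_ofPred_eq, interleavingRows,
    Fintype.mem_piFinset, Finset.mem_Icc]
  constructor
  · rintro ⟨h0, htop, hint, hstr⟩
    have hrow : ∀ j : Fin n, (ℓ j.succ : ℤ) ≤ T 1 (j + 1) ∧ T 1 (j + 1) ≤ ℓ j.castSucc := by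
      intro j
      have h := hint 0 (j + 1) (by omega) (by omega)
      have h1 := htop j.succ
      have h2 := htop j.castSucc
      simp only [Fin.val_succ, Fin.val_castSucc] at h1 h2
      simp only [Nat.add_sub_cancel, zero_add] at h
      omega
    refine ⟨fun j => (T 1 (j + 1)).toNat, ⟨fun j => ?_, fun i j hij => ?_⟩,
      fun k j => T (k + 1) (j + 1), ⟨fun k j h => h0 _ _ (by omega), fun j => ?_,
        fun k j hkj hj => ?_, fun k j hkj hj => hstr _ _ (by omega) (by omega)⟩, ?_⟩
    · have := hrow j
      simp only
      omega
    · have h1 := hrow i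
      have h2 := hrow j
      have anti : ∀ d : ℕ, (i : ℕ) + 1 + d + 1 < n + 1 →
          T 1 (i + 1 + d + 1) < T 1 (i + 1) := by
        intro d
        induction d with
        | zero => intro h; exact hstr 1 _ (by omega) h
        | succ d ih =>
          intro h
          exact (hstr 1 (i + 1 + d + 1) (by omega) h).trans (ih (by omega))
      have h3 := anti (j - i - 1) (by omega)
      rw [show (i : ℕ) + 1 + (j - i - 1) + 1 = j + 1 by omega] at h3
      simp only
      omega
    · have := hrow j
      simp only [zero_add]
      omega
    · have h := hint (k + 1) (j + 1) (by omega) (by omega)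
      rw [show j + 1 - 1 = j - 1 + 1 by omega] at h
      exact h
    · funext k j
      rcases k with _ | k
      · simp only [addTopRow]
        split_ifs with h
        · exact (htop ⟨j, h⟩).symm
        · exact (h0 _ _ (by omega)).symm
      · rcases j with _ | j
        · exact (h0 _ _ (by omega)).symm
        · rfl
  · rintro ⟨m, ⟨hm, -⟩, T, ⟨h0, htop, hint, hstr⟩, rfl⟩
    refine ⟨fun k j h => ?_, fun j => ?_, fun k j hkj hj => ?_, fun k j hkj hj => ?_⟩
    · rcases k with _ | k
      · exact dif_neg (by omega)
      · rcases j with _ | j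
        · rfl
        · exact h0 _ _ (by omega)
    · exact dif_pos j.isLt
    · obtain ⟨j, rfl⟩ : ∃ i, j = i + 1 := ⟨j - 1, by omega⟩
      rcases k with _ | k
      · have h1 := hm ⟨j, by omega⟩
        have h2 := htop ⟨j, by omega⟩
        simp only [addTopRow, Nat.add_sub_cancel]
        rw [dif_pos (by omega), dif_pos hj, h2]
        exact ⟨by exact_mod_cast h1.2, by exact_mod_cast h1.1⟩
      · have h := hint k j (by omega) (by omega)
        obtain ⟨j, rfl⟩ : ∃ i, j = i + 1 := ⟨j - 1, by omega⟩
        exact h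
    · rcases k with _ | k
      · simp only [addTopRow]
        rw [dif_pos (by omega), dif_pos hj]
        exact_mod_cast hℓ (Fin.mk_lt_mk.2 (Nat.lt_succ_self j))
      · obtain ⟨j, rfl⟩ : ∃ i, j = i + 1 := ⟨j - 1, by omega⟩
        exact hstr k j (by omega) (by omega)

lemma strictPatterns_zero (ℓ : Fin 0 → ℕ) : strictPatterns 0 ℓ = {0} := by
  ext T
  simp only [strictPatterns, Set.mem_ofPred_eq, Set.mem_singleton_iff]
  constructor
  · exact fun h => funext₂ fun k j => h.1 k j (by omega)
  · rintro rfl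
    exact ⟨fun _ _ _ => rfl, fun j => j.elim0, fun _ _ _ h => by omega, fun _ _ _ h => by omega⟩

lemma finite_strictPatterns {n : ℕ} {ℓ : Fin n → ℕ} (hℓ : StrictAnti ℓ) :
    (strictPatterns n ℓ).Finite := by
  induction n with
  | zero => rw [strictPatterns_zero]; exact Set.finite_singleton _
  | succ n ih =>
    rw [strictPatterns_succ hℓ]
    refine Set.Finite.biUnion ((interleavingRows ℓ).finite_toSet.subset fun m hm => hm.1) ?_
    exact fun m hm => (ih hm.2).image _

lemma finsum_strictPatterns_succ {n : ℕ} {ℓ : Fin (n + 1) → ℕ} (hℓ : StrictAnti ℓ)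
    (f : (ℕ → ℕ → ℤ) → ℂ) :
    ∑ᶠ T ∈ strictPatterns (n + 1) ℓ, f T =
      ∑ m ∈ (interleavingRows ℓ).filter StrictAnti,
        ∑ᶠ T ∈ strictPatterns n m, f (addTopRow (n + 1) ℓ T) := by
  rw [strictPatterns_succ hℓ, finsum_mem_biUnion]
  · rw [← finsum_mem_coe_finset]
    simp only [Finset.coe_filter]
    exact finsum_mem_congr rfl fun m _ => finsum_mem_image (addTopRow_injective _ _).injOn
  · intro m _ m' _ hne
    refine Set.disjoint_left.2 ?_
    rintro _ ⟨T, hT, rfl⟩ ⟨T', hT', h⟩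
    obtain rfl := addTopRow_injective _ _ h
    refine hne (funext fun j => ?_)
    exact_mod_cast (hT.2.1 j).symm.trans (hT'.2.1 j)
  · exact (interleavingRows ℓ).finite_toSet.subset fun m hm => hm.1
  · exact fun m hm => (finite_strictPatterns hm.2).image _

lemma patternWeight_addTopRow_of_mem {n : ℕ} (z : ℕ → ℂ) (t : ℂ) {ℓ : Fin (n + 1) → ℕ}
    {m : Fin n → ℕ} (hm : m ∈ interleavingRows ℓ) {T : ℕ → ℕ → ℤ}
    (hT : T ∈ strictPatterns n m) :
    patternWeight (n + 1) z t (addTopRow (n + 1) ℓ T) =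
      (z 0 ^ ℓ (Fin.last n) * ∏ j : Fin n,
        (entryWeight t (ℓ j.castSucc) (ℓ j.succ) (m j) * z 0 ^ (ℓ j.castSucc - m j))) *
        patternWeight n (fun k => z (k + 1)) t T := by
  have hexp : (∑ j, (ℓ j : ℤ)) - rowSum n T 0 =
      ((ℓ (Fin.last n) + ∑ j : Fin n, (ℓ j.castSucc - m j) : ℕ) : ℤ) := by
    have hcast : ∀ j : Fin n, ((ℓ j.castSucc - m j : ℕ) : ℤ) = ℓ j.castSucc - m j := fun j =>
      Nat.cast_sub (Finset.mem_Icc.1 (Fintype.mem_piFinset.1 hm j)).2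
    rw [rowSum, Finset.sum_range, Fin.sum_univ_castSucc]
    push_cast
    simp only [hcast, hT.2.1, Finset.sum_sub_distrib]
    ring
  rw [patternWeight_addTopRow, hexp, zpow_natCast, pow_add, Finset.prod_mul_distrib,
    Finset.prod_pow_eq_pow_sum]
  simp only [hT.2.1]
  ring

lemma det_sum_mul_pow {n : ℕ} (s : Fin n → Finset ℕ) (c : Fin n → ℕ → ℂ) (y : Fin n → ℂ) :
    (Matrix.of fun i j : Fin n => ∑ m ∈ s j, c j m * y i ^ m).det =
      ∑ m ∈ Fintype.piFinset s, (∏ j, c j (m j)) *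
        (Matrix.of fun i j : Fin n => y i ^ m j).det := by
  simp only [Matrix.det_apply', Matrix.of_apply, Finset.prod_univ_sum, Finset.mul_sum,
    Finset.prod_mul_distrib]
  rw [Finset.sum_comm]
  exact Finset.sum_congr rfl fun m _ => Finset.sum_congr rfl fun σ _ => by ring

lemma sub_mul_sum_entryWeight (t x y : ℂ) {a b : ℕ} (hab : b < a) :
    (x - y) * ∑ m ∈ Finset.Icc b a, entryWeight t a b m * x ^ (a - m) * y ^ m =
      (x + t * y) * (x ^ (a - b) * y ^ b - y ^ a) := by
  obtain ⟨d, rfl⟩ : ∃ d, a = b + d + 1 := ⟨a - b - 1, by omega⟩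
  have hgeom : ∀ d : ℕ, (x - y) * ∑ i ∈ range d, x ^ (d - i) * y ^ (b + (i + 1)) =
      x ^ (d + 1) * y ^ (b + 1) - x * y ^ (b + d + 1) := by
    intro d
    induction d with
    | zero => simp [pow_succ, mul_comm]
    | succ d ih =>
      rw [Finset.sum_range_succ, mul_add]
      have h : ∑ i ∈ range d, x ^ (d + 1 - i) * y ^ (b + (i + 1)) =
          x * ∑ i ∈ range d, x ^ (d - i) * y ^ (b + (i + 1)) := by
        rw [Finset.mul_sum]
        refine Finset.sum_congr rfl fun i hi => ?_
        rw [Nat.succ_sub (Finset.mem_range.1 hi).le, pow_succ]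
        ring
      rw [h, mul_left_comm, ih, Nat.add_sub_cancel_left]
      ring
  have hsum : ∑ m ∈ Finset.Icc b (b + d + 1),
      entryWeight t (b + d + 1 : ℕ) b m * x ^ (b + d + 1 - m) * y ^ m =
      (t + 1) * (∑ i ∈ range d, x ^ (d - i) * y ^ (b + (i + 1))) + x ^ (d + 1) * y ^ b +
        t * y ^ (b + d + 1) := by
    rw [← Finset.Ico_add_one_right_eq_Icc, Finset.sum_Ico_eq_sum_range,
      show b + d + 1 + 1 - b = d + 1 + 1 by omega, Finset.sum_range_succ, Finset.sum_range_succ',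
      Finset.mul_sum]
    congr 1
    · congr 1
      · refine Finset.sum_congr rfl fun i hi => ?_
        have := Finset.mem_range.1 hi
        rw [entryWeight, if_neg (by omega), if_pos (by omega),
          show b + d + 1 - (b + (i + 1)) = d - i by omega]
        ring
      · rw [entryWeight, if_neg (by omega), if_neg (by simp),
          show b + d + 1 - (b + 0) = d + 1 by omega]
        simp
    · rw [entryWeight, if_pos (by push_cast; ring), if_neg (by push_cast; simp [add_assoc]),
        show b + d + 1 - (b + (d + 1)) = 0 by omega]
      simp [add_assoc]
  rw [hsum, mul_add, mul_add, mul_left_comm, hgeom, show b + d + 1 - b = d + 1 by omega]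
  ring

/-- Eliminating the first row of the alternant `det (y i ^ ℓ j)` by column operations. -/
lemma det_pow_succ {n : ℕ} (y : Fin (n + 1) → ℂ) {ℓ : Fin (n + 1) → ℕ} (hℓ : StrictAnti ℓ) :
    (Matrix.of fun i j : Fin (n + 1) => y i ^ ℓ j).det =
      y 0 ^ ℓ (Fin.last n) * (Matrix.of fun i j : Fin n =>
        y 0 ^ (ℓ j.castSucc - ℓ j.succ) * y i.succ ^ ℓ j.succ - y i.succ ^ ℓ j.castSucc).det := by
  set c : Fin n → ℂ := fun j => y 0 ^ (ℓ j.castSucc - ℓ j.succ) with hc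
  set N : Matrix (Fin n) (Fin n) ℂ := Matrix.of fun i j =>
    c j * y i.succ ^ ℓ j.succ - y i.succ ^ ℓ j.castSucc with hN
  set B : Matrix (Fin (n + 1)) (Fin (n + 1)) ℂ := Matrix.of fun i =>
    Fin.cons (y i.rev ^ ℓ (Fin.last n)) fun j : Fin n =>
      y i.rev ^ ℓ j.succ.rev - c j.rev * y i.rev ^ ℓ j.castSucc.rev with hB
  have hA : ((Matrix.of fun i j : Fin (n + 1) => y i ^ ℓ j).submatrix
      Fin.revPerm Fin.revPerm).det = B.det := by
    refine Matrix.det_eq_of_forall_col_eq_smul_add_pred (fun j => c j.rev) ?_ ?_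
    · intro i
      simp [hB]
    · intro i j
      simp [hB]
  rw [Matrix.det_submatrix_equiv_self] at hA
  have hlast : ∀ j : Fin n, B (Fin.last n) j.succ = 0 := by
    intro j
    have hlt : ℓ j.rev.succ < ℓ j.rev.castSucc := hℓ (Fin.castSucc_lt_succ)
    simp only [hB, hc, Matrix.of_apply, Fin.cons_succ, Fin.rev_last, Fin.rev_succ,
      Fin.rev_castSucc]
    rw [← pow_add, Nat.sub_add_cancel hlt.le, sub_self]
  have hminor : B.submatrix Fin.castSucc Fin.succ = (-N).submatrix Fin.revPerm Fin.revPerm := by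
    ext i j
    simp [hB, hN, Fin.rev_castSucc, Fin.rev_succ]
  rw [hA, Matrix.det_succ_row B (Fin.last n), Fin.sum_univ_succ,
    Finset.sum_eq_zero fun j _ => by rw [hlast, mul_zero, zero_mul], add_zero,
    Fin.succAbove_last, Fin.succAbove_zero, hminor, Matrix.det_submatrix_equiv_self,
    Matrix.det_neg]
  have hB0 : B (Fin.last n) 0 = y 0 ^ ℓ (Fin.last n) := by simp [hB]
  have hsign : ((-1 : ℂ) ^ n) * (-1) ^ n = 1 := by rw [← mul_pow]; simp
  rw [hB0]
  simp only [Fin.val_last, Fin.val_zero, add_zero, Fintype.card_fin]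
  linear_combination (y 0 ^ ℓ (Fin.last n) * N.det) * hsign

lemma det_pow_eq_zero_of_not_strictAnti {n : ℕ} (y : Fin n → ℂ) {ℓ : Fin (n + 1) → ℕ}
    (hℓ : StrictAnti ℓ) {m : Fin n → ℕ} (hm : m ∈ interleavingRows ℓ) (hns : ¬ StrictAnti m) :
    (Matrix.of fun i j : Fin n => y i ^ m j).det = 0 := by
  have hm' := fun j => Finset.mem_Icc.1 (Fintype.mem_piFinset.1 hm j)
  obtain ⟨i, j, hij, hmij⟩ : ∃ i j : Fin n, i < j ∧ m i ≤ m j := by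
    simpa [StrictAnti] using hns
  refine Matrix.det_zero_of_column_eq hij.ne fun k => ?_
  have h1 : ℓ j.castSucc ≤ ℓ i.succ := hℓ.antitone (by simpa [Fin.le_def] using hij)
  have : m i = m j := by
    have := hm' i
    have := hm' j
    omega
  simp [this]

/-- The one-row branching rule for the deformed Weyl denominator. -/
lemma sum_interleavingRows_mul_prod {n : ℕ} (z : ℕ → ℂ) (t : ℂ) {ℓ : Fin (n + 1) → ℕ}
    (hℓ : StrictAnti ℓ) :
    (∑ m ∈ (interleavingRows ℓ).filter StrictAnti,
      (z 0 ^ ℓ (Fin.last n) * ∏ j : Fin n,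
        (entryWeight t (ℓ j.castSucc) (ℓ j.succ) (m j) * z 0 ^ (ℓ j.castSucc - m j))) *
        (Matrix.of fun i j : Fin n => z (i + 1) ^ m j).det) *
      ∏ i : Fin n, (z 0 - z (i + 1)) =
    (∏ i : Fin n, (z 0 + t * z (i + 1))) *
      (Matrix.of fun i j : Fin (n + 1) => z i ^ ℓ j).det := by
  have hfilter := Finset.sum_filter_of_ne (s := interleavingRows ℓ) (p := StrictAnti)
    (f := fun m => (z 0 ^ ℓ (Fin.last n) * ∏ j : Fin n,
        (entryWeight t (ℓ j.castSucc) (ℓ j.succ) (m j) * z 0 ^ (ℓ j.castSucc - m j))) *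
        (Matrix.of fun i j : Fin n => z (i + 1) ^ m j).det) (by
      intro m hm hne
      by_contra hns
      exact hne (by
        rw [det_pow_eq_zero_of_not_strictAnti (fun i : Fin n => z (i + 1)) hℓ hm hns, mul_zero]))
  rw [hfilter, det_pow_succ (fun i : Fin (n + 1) => z i) hℓ]
  simp only [mul_assoc (z 0 ^ ℓ (Fin.last n))]
  rw [← Finset.mul_sum, interleavingRows,
    ← det_sum_mul_pow (fun j : Fin n => Finset.Icc (ℓ j.succ) (ℓ j.castSucc))
      (fun j m => entryWeight t (ℓ j.castSucc) (ℓ j.succ) m * z 0 ^ (ℓ j.castSucc - m))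
      (fun i => z (i + 1)),
    mul_assoc, mul_left_comm (∏ i : Fin n, (z 0 + t * z (i + 1))), mul_comm (Matrix.det _),
    ← Matrix.det_mul_column, ← Matrix.det_mul_column]
  congr 2
  ext i j
  simp only [Matrix.of_apply, Fin.val_zero, Fin.val_succ]
  exact sub_mul_sum_entryWeight t _ _ (hℓ Fin.castSucc_lt_succ)

lemma prod_pairs_succ (n : ℕ) (f : ℕ → ℕ → ℂ) :
    ∏ i ∈ range (n + 1), ∏ j ∈ Finset.Ico (i + 1) (n + 1), f i j =
      (∏ i ∈ range n, ∏ j ∈ Finset.Ico (i + 1) n, f (i + 1) (j + 1)) *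
        ∏ j : Fin n, f 0 (j + 1) := by
  rw [Finset.prod_range_succ', ← Finset.prod_range fun j => f 0 (j + 1),
    Finset.range_eq_Ico]
  simp only [Finset.prod_Ico_add']

/-- Tokuyama's formula for an arbitrary strictly decreasing top row. -/
lemma tokuyama_strictAnti (n : ℕ) {ℓ : Fin n → ℕ} (hℓ : StrictAnti ℓ) (z : ℕ → ℂ) (t : ℂ) :
    (∑ᶠ T ∈ strictPatterns n ℓ, patternWeight n z t T) *
      ∏ i ∈ range n, ∏ j ∈ Finset.Ico (i + 1) n, (z i - z j) =
    (∏ i ∈ range n, ∏ j ∈ Finset.Ico (i + 1) n, (z i + t * z j)) *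
      (Matrix.of fun i j : Fin n => z i ^ ℓ j).det := by
  induction n generalizing z with
  | zero =>
    rw [strictPatterns_zero, finsum_mem_singleton]
    simp [patternWeight, leftCount, specialCount]
  | succ n ih =>
    rw [finsum_strictPatterns_succ hℓ, prod_pairs_succ, prod_pairs_succ, mul_assoc,
      ← sum_interleavingRows_mul_prod z t hℓ, ← mul_assoc, ← mul_assoc, Finset.sum_mul,
      Finset.mul_sum]
    congr 1
    refine Finset.sum_congr rfl fun m hm => ?_
    obtain ⟨hm, hanti⟩ := Finset.mem_filter.1 hm
    rw [finsum_mem_congr rfl fun T hT => patternWeight_addTopRow_of_mem z t hm hT,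
      ← mul_finsum_mem, mul_assoc,
      ih hanti fun k => z (k + 1)]
    ring

theorem stmt16 (n : ℕ) (hn : 1 ≤ n) (lam : ℕ → ℕ)
    (hlam : ∀ i j : ℕ, i ≤ j → j < n → lam j ≤ lam i)
    (z : ℕ → ℂ) (t : ℂ) :
    (∑ᶠ (T : ℕ → ℕ → ℤ) (_ : IsGT n lam T),
        (∏ k ∈ Finset.range n, z k ^ (rowSum n T k - rowSum n T (k + 1))) *
          t ^ leftCount n T * (t + 1) ^ specialCount n T) *
      ∏ i ∈ Finset.range n, ∏ j ∈ Finset.Ico (i + 1) n, (z i - z j)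
    = (∏ i ∈ Finset.range n, ∏ j ∈ Finset.Ico (i + 1) n, (z i + t * z j)) *
        (Matrix.of fun i j : Fin n => z i ^ (lam j + (n - 1 - (j : ℕ)))).det := by
  have hℓ : StrictAnti fun j : Fin n => lam j + (n - 1 - (j : ℕ)) := by
    intro i j hij
    have := hlam i j (Fin.le_def.1 hij.le) j.isLt
    have : (i : ℕ) < j := hij
    simp only
    omega
  have hset : {T | IsGT n lam T} =
      strictPatterns n fun j : Fin n => lam j + (n - 1 - (j : ℕ)) := by
    ext T
    refine and_congr_right fun _ => and_congr_left fun _ => ?_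
    have hcast : ∀ j : Fin n, ((lam j + (n - 1 - (j : ℕ)) : ℕ) : ℤ) = lam j + n - 1 - j := by
      intro j
      omega
    simp only [hcast]
    exact ⟨fun h j => h j j.isLt, fun h j hj => h ⟨j, hj⟩⟩
  rw [← tokuyama_strictAnti n hℓ z t, ← hset]
  rfl
end
end

section
/- For every n ≥ 1, every partition λ with at most n parts, and each 1 ≤ k ≤ n−1, the polynomial (t_{k+1} z_k + z_{k+1}) · Z_λ(z₁,…,z_n; t₁,…,t_n) is invariant under simultaneously interchanging z_k ↔ z_{k+1} and t_k ↔ t_{k+1}. -/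
open Finset

noncomputable section

/-- Partition function of one row of Gamma ice with columns `N - 1, …, 0`, read from left to
right, with vertical spins `X` on top and `W` at the bottom. The horizontal edge entering from the
left has spin `σ`, the one leaving at the right is occupied. -/
def iceRow {R : Type*} [CommRing R] (z t : R) (X W : Finset ℕ) : ℕ → Bool → R
  | 0, σ => if σ then 1 else 0
  | N + 1, false =>
    if N ∈ X then (if N ∈ W then t * iceRow z t X W N false else iceRow z t X W N true)
    else (if N ∈ W then 0 else iceRow z t X W N false)
  | N + 1, true =>
    z * (if N ∈ X then (if N ∈ W then iceRow z t X W N true else 0)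
      else (if N ∈ W then (t + 1) * iceRow z t X W N false else iceRow z t X W N true))

section

variable {R : Type*} [CommRing R]

theorem iceRow_congr (z t : R) {X X' W W' : Finset ℕ} (N : ℕ) (σ : Bool)
    (hX : ∀ c < N, (c ∈ X ↔ c ∈ X')) (hW : ∀ c < N, (c ∈ W ↔ c ∈ W')) :
    iceRow z t X W N σ = iceRow z t X' W' N σ := by
  induction N generalizing σ with
  | zero => rfl
  | succ N ih =>
    have ih' := fun σ => ih σ (fun c hc => hX c (by omega)) (fun c hc => hW c (by omega))
    cases σ <;> simp only [iceRow, ih', hX N (by omega), hW N (by omega)]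

theorem card_of_iceRow_ne_zero (z t : R) (X W : Finset ℕ) (N : ℕ) (σ : Bool)
    (h : iceRow z t X W N σ ≠ 0) :
    #{c ∈ range N | c ∈ X} + σ.toNat = #{c ∈ range N | c ∈ W} + 1 := by
  induction N generalizing σ with
  | zero => cases σ <;> simp_all [iceRow]
  | succ N ih =>
    have hf := ih false
    have ht := ih true
    simp only [range_add_one, filter_insert]
    cases σ <;> by_cases hX : N ∈ X <;> by_cases hW : N ∈ W <;>
      simp [iceRow, hX, hW] at h hf ht ⊢ <;>
      first
      | have := hf (by rintro h0; simp [h0] at h); omega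
      | have := ht (by rintro h0; simp [h0] at h); omega

/-- Partition function of two consecutive rows of Gamma ice, summed over the spins in between. -/
def iceTwoRow (z t z' t' : R) (X Y : Finset ℕ) (N : ℕ) (σ τ : Bool) : R :=
  ∑ W ∈ (range N).powerset, iceRow z t X W N σ * iceRow z' t' W Y N τ

theorem iceTwoRow_succ (z t z' t' : R) (X Y : Finset ℕ) (N : ℕ) (σ τ : Bool) :
    iceTwoRow z t z' t' X Y (N + 1) σ τ =
      match σ, τ, decide (N ∈ X), decide (N ∈ Y) with
      | false, false, false, false => iceTwoRow z t z' t' X Y N false false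
      | false, false, true, false => iceTwoRow z t z' t' X Y N true false +
          t * iceTwoRow z t z' t' X Y N false true
      | false, false, false, true => 0
      | false, false, true, true => t * t' * iceTwoRow z t z' t' X Y N false false
      | false, true, false, false => z' * iceTwoRow z t z' t' X Y N false true
      | false, true, true, false => z' * iceTwoRow z t z' t' X Y N true true
      | false, true, false, true => (t' + 1) * z' * iceTwoRow z t z' t' X Y N false false
      | false, true, true, true => (t' + 1) * z' * iceTwoRow z t z' t' X Y N true false +
          t * z' * iceTwoRow z t z' t' X Y N false true
      | true, false, false, false => z * iceTwoRow z t z' t' X Y N true false +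
          (t + 1) * z * iceTwoRow z t z' t' X Y N false true
      | true, false, true, false => z * iceTwoRow z t z' t' X Y N true true
      | true, false, false, true => (t + 1) * z * t' * iceTwoRow z t z' t' X Y N false false
      | true, false, true, true => z * t' * iceTwoRow z t z' t' X Y N true false
      | true, true, false, false => z * z' * iceTwoRow z t z' t' X Y N true true
      | true, true, true, false => 0
      | true, true, false, true => z * z' * (t' + 1) * iceTwoRow z t z' t' X Y N true false +
          (t + 1) * z * z' * iceTwoRow z t z' t' X Y N false true
      | true, true, true, true => z * z' * iceTwoRow z t z' t' X Y N true true := by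
  have key : ∀ W ∈ (range N).powerset, N ∉ W ∧
      (∀ σ, iceRow z t X (insert N W) N σ = iceRow z t X W N σ) ∧
      (∀ τ, iceRow z' t' (insert N W) Y N τ = iceRow z' t' W Y N τ) := by
    intro W hW
    refine ⟨fun h => by simpa using mem_powerset.1 hW h, fun σ => ?_, fun τ => ?_⟩ <;>
      apply iceRow_congr <;> intro c hc <;> simp [hc.ne]
  unfold iceTwoRow
  rw [range_add_one, sum_powerset_insert (by simp)]
  cases σ <;> cases τ <;> by_cases hX : N ∈ X <;> by_cases hY : N ∈ Y <;>
    simp only [hX, hY, decide_true, decide_false, mul_sum, ← sum_add_distrib] <;>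
    first
    | refine sum_congr rfl fun W hW => ?_
      obtain ⟨h1, h2, h3⟩ := key W hW
      simp only [iceRow, hX, hY, h1, h2, h3, mem_insert_self, if_true, if_false]
      ring
    | refine sum_eq_zero fun W hW => ?_
      obtain ⟨h1, h2, h3⟩ := key W hW
      simp only [iceRow, hX, hY, h1, h2, h3, mem_insert_self, if_true, if_false]
      ring

/-- The Yang–Baxter equation, propagated through all columns. -/
theorem iceTwoRow_yangBaxter (z t z' t' : R) (X Y : Finset ℕ) (N : ℕ) :
    (t' * z + z') * iceTwoRow z t z' t' X Y N false false =
        (t * z' + z) * iceTwoRow z' t' z t X Y N false false ∧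
      (t + 1) * z * iceTwoRow z t z' t' X Y N false true +
        (z - z') * iceTwoRow z t z' t' X Y N true false =
        (t * z' + z) * iceTwoRow z' t' z t X Y N false true ∧
      (t * z' - t' * z) * iceTwoRow z t z' t' X Y N false true +
        (t' + 1) * z' * iceTwoRow z t z' t' X Y N true false =
        (t * z' + z) * iceTwoRow z' t' z t X Y N true false ∧
      (t * z' + z) * iceTwoRow z t z' t' X Y N true true =
        (t * z' + z) * iceTwoRow z' t' z t X Y N true true := by
  induction N with
  | zero => simp [iceTwoRow, iceRow]
  | succ N ih =>
    obtain ⟨h00, h01, h10, h11⟩ := ih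
    simp only [iceTwoRow_succ]
    by_cases hX : N ∈ X <;> by_cases hY : N ∈ Y <;> simp only [hX, hY, decide_true, decide_false]
    · refine ⟨?_, ?_, ?_, ?_⟩
      · linear_combination t * t' * h00
      · linear_combination (t + 1) * z * h10 + t' * z * h01
      · linear_combination t * z' * h10
      · linear_combination z * z' * h11
    · refine ⟨?_, ?_, ?_, ?_⟩
      · linear_combination h10 + t' * h01
      · linear_combination z * h11
      · linear_combination z' * h11
      · trivial
    · refine ⟨?_, ?_, ?_, ?_⟩
      · ring
      · linear_combination (t + 1) * z * h00
      · linear_combination (t' + 1) * z' * t * h00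
      · linear_combination z * z' * (t + 1) * h10 + (t' + 1) * z * z' * h01
    · refine ⟨?_, ?_, ?_, ?_⟩
      · linear_combination h00
      · linear_combination z * h01
      · linear_combination z' * h10 + (t' + 1) * z' * h01
      · linear_combination z * z' * h11

/-- Interlacing of a row `x` with entries in columns `a, …, n - 1` and the row `w` below it, with
entries in columns `a + 1, …, n - 1`. -/
def Interlaces (n a : ℕ) (x w : ℕ → ℤ) : Prop :=
  ∀ j, a + 1 ≤ j → j < n → x j ≤ w j ∧ w j ≤ x (j - 1)

/-- The number of left-leaning entries of `w`. -/
def numLeft (n a : ℕ) (x w : ℕ → ℤ) : ℕ := #{j ∈ Ico (a + 1) n | w j = x (j - 1)}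

/-- The number of special entries of `w`. -/
def numSpecial (n a : ℕ) (x w : ℕ → ℤ) : ℕ :=
  #{j ∈ Ico (a + 1) n | w j ≠ x (j - 1) ∧ w j ≠ x j}

theorem interlaces_step {n a : ℕ} {x w : ℕ → ℤ} (h : a + 1 < n) :
    Interlaces n a x w ↔ (x (a + 1) ≤ w (a + 1) ∧ w (a + 1) ≤ x a) ∧ Interlaces n (a + 1) x w := by
  constructor
  · exact fun H => ⟨H (a + 1) le_rfl h, fun j hj hn => H j (by omega) hn⟩
  · rintro ⟨h1, h2⟩ j hj hn
    rcases hj.eq_or_lt with rfl | hj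
    · exact h1
    · exact h2 j hj hn

theorem numLeft_step {n a : ℕ} (x w : ℕ → ℤ) (h : a + 1 < n) :
    numLeft n a x w = (if w (a + 1) = x a then 1 else 0) + numLeft n (a + 1) x w := by
  unfold numLeft
  rw [card_filter, card_filter, sum_eq_sum_Ico_succ_bot h]
  rfl

theorem numSpecial_step {n a : ℕ} (x w : ℕ → ℤ) (h : a + 1 < n) :
    numSpecial n a x w =
      (if w (a + 1) ≠ x a ∧ w (a + 1) ≠ x (a + 1) then 1 else 0) + numSpecial n (a + 1) x w := by
  unfold numSpecial
  rw [card_filter, card_filter, sum_eq_sum_Ico_succ_bot h]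
  rfl

theorem iceRow_eq {R : Type*} [CommRing R] (z t : R) (X W : Finset ℕ) (n : ℕ) (x w : ℕ → ℤ)
    (N : ℕ) (σ : Bool) (a : ℕ) (ha : a < n)
    (hx : ∀ i j, a ≤ i → i < j → j < n → x j < x i)
    (hw : ∀ i j, a + 1 ≤ i → i < j → j < n → w j < w i)
    (hx0 : ∀ j, a ≤ j → j < n → 0 ≤ x j) (hw0 : ∀ j, a + 1 ≤ j → j < n → 0 ≤ w j)
    (hxN : ∀ j, a + 1 ≤ j → j < n → x j < N) (hwN : ∀ j, a + 1 ≤ j → j < n → w j < N)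
    (hxa : if σ then (N : ℤ) ≤ x a else x a < N)
    (hX : ∀ c < N, (c ∈ X ↔ ∃ j, a ≤ j ∧ j < n ∧ x j = c))
    (hW : ∀ c < N, (c ∈ W ↔ ∃ j, a + 1 ≤ j ∧ j < n ∧ w j = c)) :
    (¬ Interlaces n a x w → iceRow z t X W N σ = 0) ∧
    (Interlaces n a x w → ∃ e : ℕ,
      (e : ℤ) = (if σ then N - x a else 0) + ∑ j ∈ Ico a n, x j - ∑ j ∈ Ico (a + 1) n, w j ∧
      iceRow z t X W N σ = z ^ e * (t ^ numLeft n a x w * (t + 1) ^ numSpecial n a x w)) := by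
  induction N generalizing σ a with
  | zero =>
    cases σ with
    | false => have := hx0 a le_rfl ha; simp at hxa; omega
    | true =>
      have hn : n = a + 1 := by
        by_contra hne
        have := hx0 (a + 1) (by omega) (by omega)
        have := hxN (a + 1) (by omega) (by omega)
        omega
      subst hn
      refine ⟨fun h => (h fun j hj hj' => by omega).elim, fun _ => ⟨0, ?_, ?_⟩⟩ <;>
        simp [iceRow, numLeft, numSpecial]
  | succ N ih =>
    have hX' : ∀ c < N, (c ∈ X ↔ ∃ j, a ≤ j ∧ j < n ∧ x j = c) := fun c hc => hX c (by omega)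
    have hW' : ∀ c < N, (c ∈ W ↔ ∃ j, a + 1 ≤ j ∧ j < n ∧ w j = c) := fun c hc => hW c (by omega)
    have hXs : (N : ℤ) ≤ x a → ∀ c < N, (c ∈ X ↔ ∃ j, a + 1 ≤ j ∧ j < n ∧ x j = c) := by
      intro h c hc
      rw [hX' c hc]
      refine ⟨?_, fun ⟨j, h1, h2⟩ => ⟨j, by omega, h2⟩⟩
      rintro ⟨j, h1, h2, h3⟩
      have : j ≠ a := by rintro rfl; omega
      exact ⟨j, by omega, h2, h3⟩
    have hWs : a + 1 < n → w (a + 1) = N →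
        ∀ c < N, (c ∈ W ↔ ∃ j, a + 1 + 1 ≤ j ∧ j < n ∧ w j = c) := by
      intro hn h c hc
      rw [hW' c hc]
      refine ⟨?_, fun ⟨j, h1, h2⟩ => ⟨j, by omega, h2⟩⟩
      rintro ⟨j, h1, h2, h3⟩
      have : j ≠ a + 1 := by rintro rfl; omega
      exact ⟨j, by omega, h2, h3⟩
    have hNW : N ∈ W ↔ a + 1 < n ∧ w (a + 1) = N := by
      rw [hW N (by omega)]
      refine ⟨?_, fun ⟨h1, h2⟩ => ⟨a + 1, le_rfl, h1, h2⟩⟩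
      rintro ⟨j, h1, h2, h3⟩
      rcases h1.eq_or_lt with rfl | h1
      · exact ⟨h2, h3⟩
      · have := hw (a + 1) j le_rfl h1 h2
        have := hwN (a + 1) le_rfl (by omega)
        push_cast at this
        omega
    have hwN' : N ∉ W → ∀ j, a + 1 ≤ j → j < n → w j < N := by
      intro h j h1 h2
      have := hwN j h1 h2
      have : w j ≠ N := fun h' => h ((hW N (by omega)).2 ⟨j, h1, h2, h'⟩)
      push_cast at *
      omega
    have hwN2 : w (a + 1) = N → ∀ j, a + 1 + 1 ≤ j → j < n → w j < N := fun h j h1 h2 =>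
      h ▸ hw (a + 1) j le_rfl h1 h2
    have hxN' : N ∉ X → ∀ j, a + 1 ≤ j → j < n → x j < N := by
      intro h j h1 h2
      have := hxN j h1 h2
      have : x j ≠ N := fun h' => h ((hX N (by omega)).2 ⟨j, by omega, h2, h'⟩)
      push_cast at *
      omega
    have hsx := sum_eq_sum_Ico_succ_bot ha x
    cases σ with
    | false =>
      simp only [Bool.false_eq_true, if_false] at hxa
      push_cast at hxa
      have hNX : N ∈ X ↔ x a = N := by
        rw [hX N (by omega)]
        refine ⟨?_, fun h1 => ⟨a, le_rfl, ha, h1⟩⟩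
        rintro ⟨j, h1, h2, h3⟩
        rcases h1.eq_or_lt with rfl | h1
        · exact h3
        · have := hx a j le_rfl h1 h2
          omega
      have hxN2 : x a = N → ∀ j, a + 1 ≤ j → j < n → x j < N := fun h j h1 h2 =>
        h ▸ hx a j le_rfl h1 h2
      by_cases h1 : N ∈ X <;> by_cases h2 : N ∈ W <;>
        simp only [iceRow, h1, h2, if_true, if_false]
      · obtain ⟨hn, hwa⟩ := hNW.1 h2
        have hxa' := hNX.1 h1
        have := ih false (a + 1) hn (fun i j hi => hx i j (by omega))
          (fun i j hi => hw i j (by omega)) (fun j hj => hx0 j (by omega))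
          (fun j hj => hw0 j (by omega)) (fun j hj => hxN2 hxa' j (by omega)) (hwN2 hwa)
          (by simpa using hxN2 hxa' (a + 1) le_rfl hn) (hXs hxa'.ge) (hWs hn hwa)
        have hsw := sum_eq_sum_Ico_succ_bot hn w
        have hb := hxN2 hxa' (a + 1) le_rfl hn
        rw [interlaces_step hn, numLeft_step x w hn, numSpecial_step x w hn]
        refine ⟨fun h => ?_, fun h => ?_⟩
        · rw [this.1 (fun h' => h ⟨⟨by omega, by omega⟩, h'⟩), mul_zero]
        · obtain ⟨e, he, heq⟩ := this.2 h.2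
          refine ⟨e, ?_, ?_⟩
          · simp at he ⊢; omega
          · rw [heq, if_pos (by omega), if_neg (by omega)]; ring
      · have hxa' := hNX.1 h1
        have := ih true a ha hx hw hx0 hw0 (hxN2 hxa') (hwN' h2) (by simpa using hxa'.ge) hX' hW'
        refine ⟨this.1, fun h => ?_⟩
        obtain ⟨e, he, heq⟩ := this.2 h
        exact ⟨e, by simp at he ⊢; omega, heq⟩
      · obtain ⟨hn, hwa⟩ := hNW.1 h2
        refine ⟨fun _ => trivial, fun h => ?_⟩
        have := (h (a + 1) le_rfl hn).2
        have := mt hNX.2 h1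
        simp at *
        omega
      · have := mt hNX.2 h1
        exact ih false a ha hx hw hx0 hw0 (hxN' h1) (hwN' h2) (by simp; omega) hX' hW'
    | true =>
      simp only [if_true] at hxa
      push_cast at hxa
      have hNX : N ∈ X ↔ a + 1 < n ∧ x (a + 1) = N := by
        rw [hX N (by omega)]
        refine ⟨?_, fun h1 => ⟨a + 1, by omega, h1⟩⟩
        rintro ⟨j, h1, h2, h3⟩
        rcases h1.eq_or_lt with rfl | h1
        · omega
        rcases Nat.succ_le_of_lt h1 |>.eq_or_lt with rfl | h1
        · exact ⟨h2, h3⟩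
        · have := hx (a + 1) j (by omega) h1 h2
          have := hxN (a + 1) le_rfl (by omega)
          push_cast at this
          omega
      have hxN2 : x (a + 1) = N → ∀ j, a + 1 + 1 ≤ j → j < n → x j < N := fun h j h1 h2 =>
        h ▸ hx (a + 1) j (by omega) h1 h2
      by_cases h1 : N ∈ X <;> by_cases h2 : N ∈ W <;>
        simp only [iceRow, h1, h2, if_true, if_false]
      · obtain ⟨hn, hwa⟩ := hNW.1 h2
        obtain ⟨-, hxa'⟩ := hNX.1 h1
        have := ih true (a + 1) hn (fun i j hi => hx i j (by omega))
          (fun i j hi => hw i j (by omega)) (fun j hj => hx0 j (by omega))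
          (fun j hj => hw0 j (by omega)) (hxN2 hxa') (hwN2 hwa)
          (by simpa using hxa'.ge) (hXs (by omega)) (hWs hn hwa)
        have hsw := sum_eq_sum_Ico_succ_bot hn w
        have hsx' := sum_eq_sum_Ico_succ_bot hn x
        rw [interlaces_step hn, numLeft_step x w hn, numSpecial_step x w hn]
        refine ⟨fun h => ?_, fun h => ?_⟩
        · rw [this.1 (fun h' => h ⟨⟨by omega, by omega⟩, h'⟩), mul_zero]
        · obtain ⟨e, he, heq⟩ := this.2 h.2
          refine ⟨e + 1, ?_, ?_⟩
          · simp at he ⊢; omega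
          · rw [heq, if_neg (by omega), if_neg (by omega)]; ring
      · obtain ⟨hn, hxa'⟩ := hNX.1 h1
        refine ⟨fun _ => mul_zero _, fun h => ?_⟩
        have := (h (a + 1) le_rfl hn).1
        have := hwN' h2 (a + 1) le_rfl hn
        omega
      · obtain ⟨hn, hwa⟩ := hNW.1 h2
        have hb := hxN' h1 (a + 1) le_rfl hn
        have := ih false (a + 1) hn (fun i j hi => hx i j (by omega))
          (fun i j hi => hw i j (by omega)) (fun j hj => hx0 j (by omega))
          (fun j hj => hw0 j (by omega)) (fun j hj => hxN' h1 j (by omega)) (hwN2 hwa)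
          (by simpa using hb) (hXs (by omega)) (hWs hn hwa)
        have hsw := sum_eq_sum_Ico_succ_bot hn w
        rw [interlaces_step hn, numLeft_step x w hn, numSpecial_step x w hn]
        refine ⟨fun h => ?_, fun h => ?_⟩
        · rw [this.1 (fun h' => h ⟨⟨by omega, by omega⟩, h'⟩), mul_zero, mul_zero]
        · obtain ⟨e, he, heq⟩ := this.2 h.2
          refine ⟨e + 1, ?_, ?_⟩
          · simp at he ⊢; omega
          · rw [heq, if_neg (by omega), if_pos (by omega)]; ring
      · have := ih true a ha hx hw hx0 hw0 (hxN' h1) (hwN' h2) (by simp; omega) hX' hW'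
        refine ⟨fun h => by rw [this.1 h, mul_zero], fun h => ?_⟩
        obtain ⟨e, he, heq⟩ := this.2 h
        refine ⟨e + 1, by simp at he ⊢; omega, ?_⟩
        rw [heq]; ring

/-- `x` is a strictly decreasing row with entries in columns `a, …, n - 1` and values in
`0, …, N - 1`. -/
structure IsRow (n a N : ℕ) (x : ℕ → ℤ) : Prop where
  strict : ∀ i j, a ≤ i → i < j → j < n → x j < x i
  nonneg : ∀ j, a ≤ j → j < n → 0 ≤ x j
  lt : ∀ j, a ≤ j → j < n → x j < N
  eq_zero : ∀ j, ¬(a ≤ j ∧ j < n) → x j = 0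

/-- The set of values of the row `x`. -/
def rowSet (n a : ℕ) (x : ℕ → ℤ) : Finset ℕ := (Ico a n).image fun j => (x j).toNat

namespace IsRow

variable {n a N : ℕ} {x : ℕ → ℤ}

theorem mem_rowSet (hx : IsRow n a N x) (c : ℕ) :
    c ∈ rowSet n a x ↔ ∃ j, a ≤ j ∧ j < n ∧ x j = c := by
  simp only [rowSet, mem_image, mem_Ico, and_assoc]
  refine exists_congr fun j => and_congr_right fun h1 => and_congr_right fun h2 => ?_
  have := hx.nonneg j h1 h2
  omega

theorem rowSet_subset (hx : IsRow n a N x) : rowSet n a x ⊆ range N := by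
  intro c hc
  obtain ⟨j, h1, h2, h3⟩ := (hx.mem_rowSet c).1 hc
  have := hx.lt j h1 h2
  simp
  omega

theorem card_rowSet (hx : IsRow n a N x) : #(rowSet n a x) = n - a := by
  rw [rowSet, card_image_of_injOn, Nat.card_Ico]
  intro i hi j hj hij
  simp only [coe_Ico, Set.mem_Ico] at hi hj hij
  have := hx.nonneg i hi.1 hi.2
  have := hx.nonneg j hj.1 hj.2
  rcases lt_trichotomy i j with h | h | h
  · have := hx.strict i j hi.1 h hj.2
    omega
  · exact h
  · have := hx.strict j i hj.1 h hi.2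
    omega

theorem sum_range (hx : IsRow n a N x) : ∑ j ∈ range n, x j = ∑ j ∈ Ico a n, x j := by
  refine (sum_subset (fun j hj => ?_) fun j _ hj => hx.eq_zero j ?_).symm
  · simp at *; omega
  · simpa using hj

theorem toNat_eq_orderEmbOfFin (hx : IsRow n a N x) {W : Finset ℕ} (hW : rowSet n a x = W)
    (hc : #W = n - a) (i : Fin (n - a)) : (x (n - 1 - i)).toNat = W.orderEmbOfFin hc i := by
  refine congrFun (orderEmbOfFin_unique hc (f := fun i => (x (n - 1 - i)).toNat) ?_ ?_) i
  · rintro ⟨i, hi⟩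
    subst hW
    exact mem_image.2 ⟨n - 1 - i, by simp; omega, rfl⟩
  · rintro ⟨i, hi⟩ ⟨j, hj⟩ hij
    simp only [Fin.mk_lt_mk] at hij ⊢
    have := hx.strict (n - 1 - j) (n - 1 - i) (by omega) (by omega) (by omega)
    have := hx.nonneg (n - 1 - i) (by omega) (by omega)
    omega

theorem ext_rowSet {y : ℕ → ℤ} (hx : IsRow n a N x) (hy : IsRow n a N y)
    (h : rowSet n a x = rowSet n a y) : x = y := by
  funext j
  by_cases hj : a ≤ j ∧ j < n
  · have h1 := hx.toNat_eq_orderEmbOfFin h hy.card_rowSet ⟨n - 1 - j, by omega⟩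
    have h2 := hy.toNat_eq_orderEmbOfFin rfl hy.card_rowSet ⟨n - 1 - j, by omega⟩
    rw [← h2] at h1
    simp only [show n - 1 - (n - 1 - j) = j by omega] at h1
    have := hx.nonneg j hj.1 hj.2
    have := hy.nonneg j hj.1 hj.2
    omega
  · rw [hx.eq_zero j hj, hy.eq_zero j hj]

end IsRow

theorem exists_isRow {n a N : ℕ} {W : Finset ℕ} (hW : W ⊆ range N) (hc : #W = n - a) :
    ∃ w, IsRow n a N w ∧ rowSet n a w = W := by
  refine ⟨fun j => if h : a ≤ j ∧ j < n then
    (W.orderEmbOfFin hc ⟨n - 1 - j, by omega⟩ : ℤ) else 0, ⟨?_, ?_, ?_, ?_⟩, ?_⟩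
  · intro i j h1 h2 h3
    rw [dif_pos (by omega), dif_pos (by omega)]
    simp only [Nat.cast_lt, OrderEmbedding.lt_iff_lt, Fin.mk_lt_mk]
    omega
  · intro j h1 h2
    rw [dif_pos ⟨h1, h2⟩]
    positivity
  · intro j h1 h2
    rw [dif_pos ⟨h1, h2⟩]
    exact_mod_cast mem_range.1 (hW (orderEmbOfFin_mem W hc _))
  · intro j hj
    rw [dif_neg hj]
  · ext c
    simp only [rowSet, mem_image, mem_Ico]
    constructor
    · rintro ⟨j, hj, rfl⟩
      rw [dif_pos hj]
      exact orderEmbOfFin_mem W hc _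
    · intro h
      obtain ⟨⟨i, hi⟩, rfl⟩ : c ∈ Set.range (W.orderEmbOfFin hc) := by simpa using h
      refine ⟨n - 1 - i, by omega, ?_⟩
      rw [dif_pos (by omega)]
      simp only [Int.toNat_natCast]
      congr 2
      omega

/-- The factor of the weight of a pattern that depends on its consecutive rows `x` and `w`, starting
in columns `a` and `a + 1`. -/
def rowWeight (n a : ℕ) (z t : ℂ) (x w : ℕ → ℤ) : ℂ :=
  z ^ (∑ j ∈ range n, x j - ∑ j ∈ range n, w j) *
    (t ^ numLeft n a x w * (t + 1) ^ numSpecial n a x w)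

theorem iceRow_rowSet {n a N : ℕ} {x w : ℕ → ℤ} (ha : a < n) (hx : IsRow n a N x)
    (hw : IsRow n (a + 1) N w) (z t : ℂ) :
    (¬ Interlaces n a x w → iceRow z t (rowSet n a x) (rowSet n (a + 1) w) N false = 0) ∧
    (Interlaces n a x w →
      rowWeight n a z t x w = iceRow z t (rowSet n a x) (rowSet n (a + 1) w) N false) := by
  have key := iceRow_eq z t (rowSet n a x) (rowSet n (a + 1) w) n x w N false a ha hx.strict
    hw.strict hx.nonneg hw.nonneg (fun j hj => hx.lt j (by omega)) hw.lt
    (by simpa using hx.lt a le_rfl ha) (fun c _ => hx.mem_rowSet c) (fun c _ => hw.mem_rowSet c)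
  refine ⟨key.1, fun h => ?_⟩
  obtain ⟨e, he, heq⟩ := key.2 h
  rw [heq, rowWeight, hx.sum_range, hw.sum_range, ← zpow_natCast z e, he]
  simp

namespace IsGT

variable {n : ℕ} {lam : ℕ → ℕ} {T : ℕ → ℕ → ℤ}

theorem interlaces (hT : IsGT n lam T) (r : ℕ) : Interlaces n r (T r) (T (r + 1)) :=
  fun j h1 h2 => ⟨(hT.2.2.1 r j h1 h2).2, (hT.2.2.1 r j h1 h2).1⟩

theorem bounds (hlam : ∀ i j : ℕ, i ≤ j → j < n → lam j ≤ lam i) (hT : IsGT n lam T) (r j : ℕ)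
    (hr : r ≤ j) (hj : j < n) : 0 ≤ T r j ∧ T r j < (lam 0 + n : ℕ) := by
  induction r generalizing j with
  | zero =>
    rw [hT.2.1 j hj]
    have := hlam 0 j (by omega) hj
    omega
  | succ r ih =>
    have h1 := ih (j - 1) (by omega) (by omega)
    have h2 := ih j (by omega) hj
    have := hT.2.2.1 r j hr hj
    omega

theorem isRow (hlam : ∀ i j : ℕ, i ≤ j → j < n → lam j ≤ lam i) (hT : IsGT n lam T) (r : ℕ) :
    IsRow n r (lam 0 + n) (T r) where
  strict i j hi hij hj := by
    induction j, hij using Nat.le_induction with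
    | base => exact hT.2.2.2 r i hi hj
    | succ j hij ih =>
      exact (hT.2.2.2 r j (by omega) hj).trans (ih (by omega))
  nonneg j h1 h2 := (hT.bounds hlam r j h1 h2).1
  lt j h1 h2 := (hT.bounds hlam r j h1 h2).2
  eq_zero j := hT.1 r j

theorem update {N k : ℕ} {w : ℕ → ℤ} (hT : IsGT n lam T) (hw : IsRow n (k + 1) N w)
    (h1 : Interlaces n k (T k) w) (h2 : Interlaces n (k + 1) w (T (k + 2))) :
    IsGT n lam (Function.update T (k + 1) w) := by
  refine ⟨fun r j h => ?_, fun j hj => ?_, fun r j hr hj => ?_, fun r j hr hj => ?_⟩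
  · by_cases h' : r = k + 1
    · subst h'
      simpa using hw.eq_zero j h
    · simpa [h'] using hT.1 r j h
  · simpa using hT.2.1 j hj
  · by_cases h' : r = k + 1
    · subst h'
      simpa using (h2 j hr hj).symm
    · by_cases h'' : r = k
      · subst h''
        simpa using (h1 j hr hj).symm
      · simpa [h', h''] using hT.2.2.1 r j hr hj
  · by_cases h' : r = k + 1
    · subst h'
      simpa using hw.strict j (j + 1) hr (by omega) hj
    · simpa [h'] using hT.2.2.2 r j hr hj

end IsGT

theorem finite_setOf_isGT {n : ℕ} {lam : ℕ → ℕ}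
    (hlam : ∀ i j : ℕ, i ≤ j → j < n → lam j ≤ lam i) : {T | IsGT n lam T}.Finite := by
  let f : (ℕ → ℕ → ℤ) → Fin n → Fin n → ℤ := fun T r j => T r j
  refine Set.Finite.of_finite_image (f := f)
    ((Set.Finite.pi fun _ => Set.Finite.pi fun _ => Set.finite_Icc 0 ((lam 0 + n : ℕ) : ℤ)).subset
      (s := Set.univ.pi fun _ => Set.univ.pi fun _ => Set.Icc 0 ((lam 0 + n : ℕ) : ℤ)) ?_) ?_
  · rintro _ ⟨T, hT, rfl⟩ r - j -
    by_cases h : (r : ℕ) ≤ j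
    · have := IsGT.bounds hlam hT r j h j.2
      exact ⟨this.1, this.2.le⟩
    · simp only [f, hT.1 r j (by omega), Set.mem_Icc]
      omega
  · intro T hT T' hT' h
    funext r j
    by_cases hr : r ≤ j ∧ j < n
    · exact congrFun (congrFun h ⟨r, by omega⟩) ⟨j, hr.2⟩
    · rw [hT.1 r j hr, hT'.1 r j hr]

theorem leftRow_succ (n r : ℕ) (T : ℕ → ℕ → ℤ) :
    leftRow n (r + 1) T = numLeft n r (T r) (T (r + 1)) := by
  unfold leftRow numLeft
  congr 1
  ext j
  simp only [mem_filter, mem_range, mem_Ico, Nat.add_sub_cancel]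
  tauto

theorem specialRow_succ (n r : ℕ) (T : ℕ → ℕ → ℤ) :
    specialRow n (r + 1) T = numSpecial n r (T r) (T (r + 1)) := by
  unfold specialRow numSpecial
  congr 1
  ext j
  simp only [mem_filter, mem_range, mem_Ico, Nat.add_sub_cancel]
  tauto

theorem Zice_eq {n : ℕ} {lam : ℕ → ℕ} (hlam : ∀ i j : ℕ, i ≤ j → j < n → lam j ≤ lam i)
    (z t : ℕ → ℂ) : Zice n lam z t = ∑ T ∈ (finite_setOf_isGT hlam).toFinset,
      ∏ r ∈ range n, rowWeight n r (z r) (t r) (T r) (T (r + 1)) := by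
  refine (finsum_mem_eq_finite_toFinset_sum _ (finite_setOf_isGT hlam)).trans
    (sum_congr rfl fun T _ => ?_)
  simp only [rowWeight, prod_mul_distrib, leftRow_succ, specialRow_succ, rowSum]
  rcases n with _ | m
  · simp
  · simp [prod_range_succ _ m, numLeft, numSpecial]

/-- Summing over the patterns that agree with `T₀` outside row `k + 1`. -/
theorem sum_fiber [DecidableEq (ℕ → ℕ → ℤ)] {n : ℕ} {lam : ℕ → ℕ} (hlam : ∀ i j : ℕ, i ≤ j → j < n → lam j ≤ lam i)
    {k : ℕ} (hk : k + 1 < n) {T₀ : ℕ → ℕ → ℤ} (hT₀ : IsGT n lam T₀) (z t : ℕ → ℂ) :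
    ∑ T ∈ (finite_setOf_isGT hlam).toFinset with
        Function.update T (k + 1) 0 = Function.update T₀ (k + 1) 0,
      ∏ r ∈ range n, rowWeight n r (z r) (t r) (T r) (T (r + 1)) =
    (∏ r ∈ ((range n).erase k).erase (k + 1),
      rowWeight n r (z r) (t r) (T₀ r) (T₀ (r + 1))) *
      iceTwoRow (z k) (t k) (z (k + 1)) (t (k + 1)) (rowSet n k (T₀ k))
        (rowSet n (k + 2) (T₀ (k + 2))) (lam 0 + n) false false := by
  have hrow : ∀ {T : ℕ → ℕ → ℤ},
      Function.update T (k + 1) 0 = Function.update T₀ (k + 1) 0 → ∀ r ≠ k + 1, T r = T₀ r := by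
    intro T h r hr
    simpa [hr] using congrFun h r
  rw [iceTwoRow, mul_sum]
  refine sum_of_injOn (fun T => rowSet n (k + 1) (T (k + 1))) ?_ ?_ ?_ ?_
  · intro T hT T' hT' h
    simp only [coe_filter, Set.Finite.mem_toFinset, Set.mem_ofPred_eq] at hT hT'
    funext r
    by_cases hr : r = k + 1
    · subst hr
      exact (hT.1.isRow hlam _).ext_rowSet (hT'.1.isRow hlam _) h
    · rw [hrow hT.2 r hr, hrow hT'.2 r hr]
  · intro T hT
    simp only [coe_filter, Set.Finite.mem_toFinset, Set.mem_ofPred_eq] at hT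
    exact mem_coe.2 (mem_powerset.2 (hT.1.isRow hlam (k + 1)).rowSet_subset)
  · intro W hW hW'
    by_contra hne
    have hne1 := left_ne_zero_of_mul (right_ne_zero_of_mul hne)
    have hne2 := right_ne_zero_of_mul (right_ne_zero_of_mul hne)
    have hx := hT₀.isRow hlam k
    have hWN := mem_powerset.1 hW
    have hcard := card_of_iceRow_ne_zero _ _ _ _ _ _ hne1
    rw [filter_mem_eq_inter, filter_mem_eq_inter, inter_eq_right.2 hWN,
      inter_eq_right.2 hx.rowSet_subset, hx.card_rowSet] at hcard
    simp only [Bool.toNat_false] at hcard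
    obtain ⟨w, hw, rfl⟩ := exists_isRow (n := n) (a := k + 1) hWN (by omega)
    have h1 := not_imp_comm.1 (iceRow_rowSet (by omega) hx hw _ _).1 hne1
    have h2 := not_imp_comm.1 (iceRow_rowSet hk hw (hT₀.isRow hlam (k + 2)) _ _).1 hne2
    refine hW' ⟨Function.update T₀ (k + 1) w, ?_, by simp⟩
    simpa using hT₀.update hw h1 h2
  · intro T hT
    simp only [mem_filter, Set.Finite.mem_toFinset, Set.mem_ofPred_eq] at hT
    obtain ⟨hT, hTT⟩ := hT
    have hx := hT₀.isRow hlam k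
    have hw := hT.isRow hlam (k + 1)
    have hy := hT₀.isRow hlam (k + 2)
    have hTk := hrow hTT k (by omega)
    have hTk2 := hrow hTT (k + 2) (by omega)
    rw [← (iceRow_rowSet (by omega) hx hw _ _).2 (hTk ▸ hT.interlaces k),
      ← (iceRow_rowSet hk hw hy _ _).2 (hTk2 ▸ hT.interlaces (k + 1)),
      ← mul_prod_erase (range n) _ (mem_range.2 (show k < n by omega)),
      ← mul_prod_erase ((range n).erase k) _ (a := k + 1) (by simp [hk]), hTk, hTk2]
    rw [prod_congr rfl fun r hr => ?_]
    · ring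
    · simp only [mem_erase] at hr
      rw [hrow hTT r hr.1, hrow hTT (r + 1) (by omega)]

theorem stmt18 (n : ℕ) (hn : 1 ≤ n) (lam : ℕ → ℕ)
    (hlam : ∀ i j : ℕ, i ≤ j → j < n → lam j ≤ lam i)
    (k : ℕ) (hk : k + 1 < n) (z t : ℕ → ℂ) :
    (t (k + 1) * z k + z (k + 1)) * Zice n lam z t
      = (t k * z (k + 1) + z k) *
          Zice n lam (z ∘ Equiv.swap k (k + 1)) (t ∘ Equiv.swap k (k + 1)) := by
  classical
  let g : (ℕ → ℕ → ℤ) → ℕ → ℕ → ℤ := fun T => Function.update T (k + 1) 0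
  have hg : ∀ T ∈ (finite_setOf_isGT hlam).toFinset,
      g T ∈ (finite_setOf_isGT hlam).toFinset.image g := fun T => mem_image_of_mem g
  rw [Zice_eq hlam, Zice_eq hlam, ← sum_fiberwise_of_maps_to hg, ← sum_fiberwise_of_maps_to hg,
    mul_sum, mul_sum]
  refine sum_congr rfl fun U hU => ?_
  obtain ⟨T₀, hT₀, rfl⟩ := mem_image.1 hU
  have hT₀ : IsGT n lam T₀ := by simpa using hT₀
  rw [sum_fiber hlam hk hT₀, sum_fiber hlam hk hT₀]
  have hprod : ∏ r ∈ ((range n).erase k).erase (k + 1),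
        rowWeight n r ((z ∘ Equiv.swap k (k + 1)) r) ((t ∘ Equiv.swap k (k + 1)) r)
          (T₀ r) (T₀ (r + 1)) =
      ∏ r ∈ ((range n).erase k).erase (k + 1),
        rowWeight n r (z r) (t r) (T₀ r) (T₀ (r + 1)) := by
    refine prod_congr rfl fun r hr => ?_
    simp only [mem_erase] at hr
    simp only [Function.comp_apply, Equiv.swap_apply_of_ne_of_ne hr.2.1 hr.1]
  rw [hprod]
  simp only [Function.comp_apply, Equiv.swap_apply_left, Equiv.swap_apply_right]
  rw [mul_left_comm, (iceTwoRow_yangBaxter _ _ _ _ _ _ _).1, mul_left_comm]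
end
end
end
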